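/- arXiv:2511.05069 — 3 statements merged into one kernel-verified Lean document; each statement's English description precedes it below -/
import Mathlib

section
/- Let X be a nonempty compact metric space and T : X → X a uniquely ergodic homeomorphism, with unique T-invariant Borel probability measure μ. Let φ : X → ℝ be a continuous function with ∫_X φ dμ = 0. Then there exists a φ-conformal Borel probability measure ν for T, i.e. a probability measure ν such that the pushforward (T⁻¹)_*ν equals the measure with density e^φ with respect to ν (so for every Borel set B, ν(T(B)) = ∫_B e^{φ} dν). -/
open MeasureTheory
open scoped ENNReal

open Filter Topology Finset

section

theorem sum_range_succ_exp_pos (s : ℕ → ℝ) (n : ℕ) :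
    0 < ∑ k ∈ range (n + 1), Real.exp (s k) :=
  sum_pos (fun _ _ => Real.exp_pos _) nonempty_range_add_one

/-- A sequence of partial sums of `exp ∘ s` cannot grow geometrically when `s` is nonnegative and
grows sublinearly. -/
theorem exists_one_add_exp_div_sum_exp_lt {s : ℕ → ℝ} (hs : ∀ n, 0 ≤ s n)
    (hsub : ∀ ε > 0, ∃ C, ∀ n, s n ≤ C + ε * n) {η : ℝ} (hη : 0 < η) :
    ∃ n, (1 + Real.exp (s (n + 1))) / ∑ k ∈ range (n + 1), Real.exp (s k) < η := by
  by_contra! hcon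
  have hstep (n : ℕ) :
      η / 2 * ∑ k ∈ range (n + 1), Real.exp (s k) ≤ Real.exp (s (n + 1)) := by
    have h := (le_div_iff₀ (sum_range_succ_exp_pos s n)).1 (hcon n)
    have := Real.one_le_exp (hs (n + 1))
    linarith
  have hgeom (n : ℕ) : (1 + η / 2) ^ n ≤ ∑ k ∈ range (n + 1), Real.exp (s k) := by
    induction n with
    | zero => simpa using hs 0
    | succ n ih =>
      rw [sum_range_succ, pow_succ]
      have := mul_le_mul_of_nonneg_right ih (by positivity : 0 ≤ 1 + η / 2)
      linarith [hstep n]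
  have hr : 0 < Real.log (1 + η / 2) := Real.log_pos (by linarith)
  have hlow (n : ℕ) : Real.log (η / 2) + n * Real.log (1 + η / 2) ≤ s (n + 1) := by
    rw [← Real.log_pow, ← Real.log_mul (by positivity) (by positivity),
      Real.log_le_iff_le_exp (by positivity)]
    exact (mul_le_mul_of_nonneg_left (hgeom n) (by positivity)).trans (hstep n)
  obtain ⟨C, hC⟩ := hsub (Real.log (1 + η / 2) / 2) (by positivity)
  obtain ⟨n, hn⟩ := exists_nat_gt
    ((C + Real.log (1 + η / 2) / 2 - Real.log (η / 2)) / (Real.log (1 + η / 2) / 2))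
  rw [div_lt_iff₀ (by positivity)] at hn
  have h₁ := hlow n
  have h₂ := hC (n + 1)
  push_cast at h₂
  nlinarith

variable {X : Type*} [MetricSpace X]

theorem continuous_birkhoffSum {T : X → X} (hT : Continuous T) {f : X → ℝ} (hf : Continuous f)
    (n : ℕ) : Continuous (birkhoffSum T f n) := by
  unfold birkhoffSum
  exact continuous_finsetSum _ fun k _ => hf.comp (hT.iterate k)

variable [CompactSpace X]

/-- If every point has a negative Birkhoff sum, then the Birkhoff sums tend to `-∞` at a uniform
linear rate. -/
theorem exists_forall_birkhoffSum_le_sub {T : X → X} (hT : Continuous T) {f : X → ℝ}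
    (hf : Continuous f) (hneg : ∀ x, ∃ n, birkhoffSum T f n x < 0) :
    ∃ ε > 0, ∃ C, ∀ n x, birkhoffSum T f n x ≤ C - ε * n := by
  let U : ℕ → Set X := fun m => ⋃ n ∈ Set.Icc 1 m, {x | (m + 1) * birkhoffSum T f n x < -n}
  have hUo (m : ℕ) : IsOpen (U m) := isOpen_biUnion fun n _ =>
    isOpen_lt (continuous_const.mul (continuous_birkhoffSum hT hf n)) continuous_const
  have hUmono : Monotone U := by
    intro m m' hm x hx
    simp only [U, Set.mem_iUnion, Set.mem_ofPred_eq, Set.mem_Icc] at hx ⊢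
    obtain ⟨n, ⟨hn1, hnm⟩, h⟩ := hx
    refine ⟨n, ⟨hn1, hnm.trans hm⟩, lt_of_le_of_lt ?_ h⟩
    have hlt : birkhoffSum T f n x ≤ 0 := by
      by_contra! h0
      have : (0 : ℝ) ≤ n := n.cast_nonneg
      have : 0 < ((m : ℝ) + 1) * birkhoffSum T f n x := by positivity
      linarith
    have : (m : ℝ) ≤ m' := by exact_mod_cast hm
    nlinarith
  have hUcover : (Set.univ : Set X) ⊆ ⋃ m, U m := by
    intro x _
    obtain ⟨n, hn⟩ := hneg x
    obtain ⟨m, hm⟩ := exists_nat_gt (n / -birkhoffSum T f n x)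
    rw [div_lt_iff₀ (by linarith)] at hm
    have hn1 : 1 ≤ n := by
      rcases Nat.eq_zero_or_pos n with rfl | h
      · simp at hn
      · exact h
    simp only [U, Set.mem_iUnion, Set.mem_ofPred_eq, Set.mem_Icc]
    refine ⟨max n m, n, ⟨hn1, le_max_left _ _⟩, ?_⟩
    have : (m : ℝ) ≤ (max n m : ℕ) := by exact_mod_cast le_max_right n m
    nlinarith
  obtain ⟨N, hN⟩ := isCompact_univ.elim_directed_cover U hUo hUcover hUmono.directed_le
  obtain ⟨M, hM⟩ := isCompact_univ.exists_bound_of_continuousOn hf.continuousOn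
  let K := max M 0
  have hK (x : X) : f x ≤ K :=
    (le_abs_self _).trans ((hM x trivial).trans (le_max_left _ _))
  have hK0 : 0 ≤ K := le_max_right _ _
  let ε : ℝ := 1 / (N + 1)
  have hε : 0 < ε := by positivity
  refine ⟨ε, hε, N * (K + ε), fun n => ?_⟩
  induction n using Nat.strong_induction_on with
  | _ n ih =>
    intro x
    rcases le_or_gt n N with hn | hn
    · have h : birkhoffSum T f n x ≤ n * K := by
        simpa [birkhoffSum] using sum_le_card_nsmul (range n) (fun k => f (T^[k] x)) K
          fun k _ => hK _
      have : (n : ℝ) ≤ N := by exact_mod_cast hn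
      nlinarith
    · obtain ⟨m, ⟨hm1, hmN⟩, h⟩ : ∃ m, (1 ≤ m ∧ m ≤ N) ∧
          (N + 1) * birkhoffSum T f m x < -m := by
        simpa [U] using hN (Set.mem_univ x)
      obtain ⟨j, rfl⟩ := Nat.exists_eq_add_of_le (hmN.trans hn.le)
      have hj := ih j (by omega) (T^[m] x)
      have h' : birkhoffSum T f m x ≤ -(ε * m) := by
        have : birkhoffSum T f m x < -m / (N + 1) := by
          rw [lt_div_iff₀ (by positivity)]; linarith
        refine this.le.trans_eq ?_
        simp only [ε]; ring
      rw [birkhoffSum_add]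
      push_cast
      linarith

variable [MeasurableSpace X] [BorelSpace X]

theorem Continuous.integrable_of_compactSpace {f : X → ℝ} (hf : Continuous f) (μ : Measure X)
    [IsFiniteMeasure μ] : Integrable f μ :=
  hf.integrable_of_hasCompactSupport (HasCompactSupport.of_compactSpace f)

theorem integral_birkhoffSum {T : X → X} (hT : Continuous T) {μ : Measure X} [IsFiniteMeasure μ]
    (hinv : μ.map T = μ) {f : X → ℝ} (hf : Continuous f) (n : ℕ) :
    ∫ x, birkhoffSum T f n x ∂μ = n * ∫ x, f x ∂μ := by
  simp only [birkhoffSum]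
  have hint (k : ℕ) : Integrable (fun x => f (T^[k] x)) μ :=
    (hf.comp (hT.iterate k)).integrable_of_compactSpace μ
  rw [integral_finsetSum _ fun k _ => hint k]
  have h (k : ℕ) : ∫ x, f (T^[k] x) ∂μ = ∫ x, f x ∂μ := by
    have hk : MeasurePreserving T^[k] μ μ := MeasurePreserving.iterate ⟨hT.measurable, hinv⟩ k
    rw [← integral_map hk.aemeasurable hf.aestronglyMeasurable, hk.map_eq]
  simp [h]

/-- **Peres' lemma** at level zero: some orbit has only nonnegative Birkhoff sums. -/
theorem exists_forall_birkhoffSum_nonneg {T : X → X} (hT : Continuous T) {μ : Measure X}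
    [IsProbabilityMeasure μ] (hinv : μ.map T = μ) {f : X → ℝ} (hf : Continuous f)
    (hint : 0 ≤ ∫ x, f x ∂μ) : ∃ x, ∀ n, 0 ≤ birkhoffSum T f n x := by
  by_contra! hneg
  obtain ⟨ε, hε, C, hC⟩ := exists_forall_birkhoffSum_le_sub hT hf hneg
  obtain ⟨n, hn⟩ := exists_nat_gt (C / ε)
  rw [div_lt_iff₀ hε] at hn
  have h : ∫ x, birkhoffSum T f n x ∂μ ≤ ∫ _, (C - ε * n) ∂μ :=
    integral_mono ((continuous_birkhoffSum hT hf n).integrable_of_compactSpace μ)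
      (integrable_const _) (hC n)
  rw [integral_birkhoffSum hT hinv hf] at h
  simp only [integral_const, probReal_univ, one_smul] at h
  have : 0 ≤ n * ∫ x, f x ∂μ := by positivity
  linarith

/-- A measure is conformal as soon as it satisfies the change of variables formula for continuous
functions. -/
theorem map_symm_eq_withDensity_exp {T : X ≃ₜ X} {ν : Measure X} [IsFiniteMeasure ν] {ψ : X → ℝ}
    (hψ : Continuous ψ)
    (h : ∀ g : X → ℝ, Continuous g → ∫ x, Real.exp (ψ x) * g (T x) ∂ν = ∫ x, g x ∂ν) :
    ν.map (T.symm : X → X) = ν.withDensity fun x => ENNReal.ofReal (Real.exp (ψ x)) := by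
  have hexp : Continuous fun x => Real.exp (ψ x) := Real.continuous_exp.comp hψ
  have : IsFiniteMeasure (ν.withDensity fun x => ENNReal.ofReal (Real.exp (ψ x))) :=
    isFiniteMeasure_withDensity_ofReal (hexp.integrable_of_compactSpace ν).2
  refine ext_of_forall_integral_eq_of_IsFiniteMeasure fun f => ?_
  rw [integral_map T.symm.continuous.aemeasurable f.continuous.aestronglyMeasurable,
    integral_withDensity_eq_integral_toReal_smul hexp.measurable.ennreal_ofReal (by simp)]
  rw [← h (fun x => f (T.symm x)) (f.continuous.comp T.symm.continuous)]
  simp [ENNReal.toReal_ofReal (Real.exp_nonneg _)]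

/-- The probability measure on the first `n + 1` points of the orbit of `x`, with weights
proportional to `exp (birkhoffSum T ψ k x)`. -/
noncomputable def weightedOrbitMeasure (T : X → X) (ψ : X → ℝ) (x : X) (n : ℕ) : Measure X :=
  ∑ k ∈ range (n + 1), ENNReal.ofReal (Real.exp (birkhoffSum T ψ k x) /
    ∑ j ∈ range (n + 1), Real.exp (birkhoffSum T ψ j x)) • Measure.dirac (T^[k] x)

instance isProbabilityMeasure_weightedOrbitMeasure (T : X → X) (ψ : X → ℝ) (x : X) (n : ℕ) :
    IsProbabilityMeasure (weightedOrbitMeasure T ψ x n) := by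
  have hW := sum_range_succ_exp_pos (birkhoffSum T ψ · x) n
  constructor
  simp only [weightedOrbitMeasure, Measure.coe_finsetSum, Finset.sum_apply, Measure.smul_apply,
    measure_univ, smul_eq_mul, mul_one]
  rw [← ENNReal.ofReal_sum_of_nonneg fun k _ => by positivity, ← sum_div, div_self hW.ne',
    ENNReal.ofReal_one]

theorem integral_weightedOrbitMeasure (T : X → X) (ψ : X → ℝ) (x : X) (n : ℕ) {g : X → ℝ}
    (hg : Continuous g) :
    ∫ y, g y ∂(weightedOrbitMeasure T ψ x n) =
      (∑ k ∈ range (n + 1), Real.exp (birkhoffSum T ψ k x) * g (T^[k] x)) /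
        ∑ k ∈ range (n + 1), Real.exp (birkhoffSum T ψ k x) := by
  have hW := sum_range_succ_exp_pos (birkhoffSum T ψ · x) n
  rw [weightedOrbitMeasure, integral_finsetSum_measure fun k _ =>
    (hg.integrable_of_compactSpace _).smul_measure ENNReal.ofReal_ne_top, sum_div]
  refine sum_congr rfl fun k _ => ?_
  rw [integral_smul_measure, integral_dirac, ENNReal.toReal_ofReal (by positivity), smul_eq_mul]
  ring

/-- The failure of the weighted orbit measures to be conformal comes from the endpoints of the
orbit segment. -/
theorem abs_integral_weightedOrbitMeasure_sub_le {T : X → X} (hT : Continuous T) {ψ : X → ℝ}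
    (hψ : Continuous ψ) (x : X) (n : ℕ) {g : X → ℝ} (hg : Continuous g) {M : ℝ}
    (hM : ∀ y, |g y| ≤ M) :
    |∫ y, Real.exp (ψ y) * g (T y) ∂(weightedOrbitMeasure T ψ x n) -
        ∫ y, g y ∂(weightedOrbitMeasure T ψ x n)| ≤
      M * ((1 + Real.exp (birkhoffSum T ψ (n + 1) x)) /
        ∑ k ∈ range (n + 1), Real.exp (birkhoffSum T ψ k x)) := by
  have hW := sum_range_succ_exp_pos (birkhoffSum T ψ · x) n
  have hg' : Continuous fun y => Real.exp (ψ y) * g (T y) :=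
    (Real.continuous_exp.comp hψ).mul (hg.comp hT)
  rw [integral_weightedOrbitMeasure T ψ x n hg, integral_weightedOrbitMeasure T ψ x n hg',
    ← sub_div, ← sum_sub_distrib]
  have hterm (k : ℕ) : Real.exp (birkhoffSum T ψ k x) *
        (Real.exp (ψ (T^[k] x)) * g (T (T^[k] x))) =
      Real.exp (birkhoffSum T ψ (k + 1) x) * g (T^[k + 1] x) := by
    rw [birkhoffSum_succ, Real.exp_add, Function.iterate_succ_apply', mul_assoc]
  simp_rw [hterm]
  rw [sum_range_sub fun k => Real.exp (birkhoffSum T ψ k x) * g (T^[k] x), abs_div,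
    abs_of_pos hW, ← mul_div_assoc]
  gcongr
  simp only [birkhoffSum_zero, Real.exp_zero, one_mul, Function.iterate_zero, id_eq]
  refine (abs_sub _ _).trans ?_
  rw [abs_mul, Real.abs_exp]
  have := mul_le_mul_of_nonneg_left (hM (T^[n + 1] x))
    (Real.exp_nonneg (birkhoffSum T ψ (n + 1) x))
  linarith [hM x]

/-- Along an orbit whose Birkhoff sums are nonnegative and sublinear, the weighted orbit measures
accumulate at a conformal measure. -/
theorem exists_conformal_of_sublinear_birkhoffSum {T : X ≃ₜ X} {ψ : X → ℝ} (hψ : Continuous ψ)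
    {x : X} (hnonneg : ∀ n, 0 ≤ birkhoffSum T ψ n x)
    (hsub : ∀ ε > 0, ∃ C, ∀ n, birkhoffSum T ψ n x ≤ C + ε * n) :
    ∃ ν : Measure X, IsProbabilityMeasure ν ∧
      (ν.map (T.symm : X → X) = ν.withDensity fun y => ENNReal.ofReal (Real.exp (ψ y))) ∧
      ∀ (f : X → ℝ) (c : ℝ), Continuous f →
        (∀ n, c ≤ ∫ y, f y ∂(weightedOrbitMeasure T ψ x n)) → c ≤ ∫ y, f y ∂ν := by
  let d : ℕ → ℝ := fun n => (1 + Real.exp (birkhoffSum T ψ (n + 1) x)) /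
    ∑ k ∈ range (n + 1), Real.exp (birkhoffSum T ψ k x)
  have hd0 (n : ℕ) : 0 ≤ d n :=
    div_nonneg (by positivity) (sum_range_succ_exp_pos (birkhoffSum T ψ · x) n).le
  have : (comap d (𝓝 0)).NeBot := comap_neBot fun s hs => by
    obtain ⟨ε, hε, hball⟩ := Metric.mem_nhds_iff.1 hs
    obtain ⟨n, hn⟩ := exists_one_add_exp_div_sum_exp_lt hnonneg hsub hε
    refine ⟨n, hball ?_⟩
    rw [Metric.mem_ball, Real.dist_0_eq_abs, abs_of_nonneg (hd0 n)]
    exact hn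
  let F := Ultrafilter.of (comap d (𝓝 0))
  have hdF : Tendsto d F (𝓝 0) := tendsto_comap.mono_left (Ultrafilter.of_le _)
  let p : ℕ → ProbabilityMeasure X := fun n => ⟨weightedOrbitMeasure T ψ x n, inferInstance⟩
  obtain ⟨ν, -, hν⟩ := isCompact_univ.ultrafilter_le_nhds (F.map p) (by simp)
  have hlim (g : X → ℝ) (hg : Continuous g) :
      Tendsto (fun n => ∫ y, g y ∂(weightedOrbitMeasure T ψ x n)) F (𝓝 (∫ y, g y ∂ν)) :=
    ProbabilityMeasure.tendsto_iff_forall_integral_tendsto.1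
      (show Tendsto p F (𝓝 ν) from hν) (BoundedContinuousFunction.mkOfCompact ⟨g, hg⟩)
  refine ⟨ν, inferInstance, map_symm_eq_withDensity_exp hψ fun g hg => ?_,
    fun f c hf hc => ge_of_tendsto' (hlim f hf) hc⟩
  obtain ⟨M, hM⟩ := isCompact_univ.exists_bound_of_continuousOn hg.continuousOn
  have hg' : Continuous fun y => Real.exp (ψ y) * g (T y) :=
    (Real.continuous_exp.comp hψ).mul (hg.comp T.continuous)
  refine sub_eq_zero.1 (tendsto_nhds_unique ((hlim _ hg').sub (hlim g hg)) ?_)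
  refine squeeze_zero_norm (a := fun n => M * d n) (fun n => ?_) (by simpa using hdF.const_mul M)
  exact abs_integral_weightedOrbitMeasure_sub_le T.continuous hψ x n hg fun y => hM y trivial

/-- For a uniquely ergodic homeomorphism, the Birkhoff sums of a continuous function of integral
zero are uniformly bounded above by a sublinear function. -/
theorem exists_forall_birkhoffSum_le_add_of_uniquelyErgodic {T : X ≃ₜ X} {μ : Measure X}
    (huniq : ∀ μ' : Measure X, IsProbabilityMeasure μ' → μ'.map (T : X → X) = μ' → μ' = μ)
    {f : X → ℝ} (hf : Continuous f) (hint : ∫ x, f x ∂μ = 0) {ε : ℝ} (hε : 0 < ε) :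
    ∃ C, ∀ n x, birkhoffSum T f n x ≤ C + ε * n := by
  have hsum (n : ℕ) (x : X) :
      birkhoffSum T (fun y => f y - ε) n x = birkhoffSum T f n x - ε * n := by
    simp [birkhoffSum, mul_comm]
  by_cases hneg : ∀ x, ∃ n, birkhoffSum T (fun y => f y - ε) n x < 0
  · obtain ⟨δ, hδ, C, hC⟩ :=
      exists_forall_birkhoffSum_le_sub T.continuous (f := fun y => f y - ε)
        (hf.sub continuous_const) hneg
    refine ⟨C, fun n x => ?_⟩
    have h := hC n x
    rw [hsum] at h
    have : 0 ≤ δ * n := by positivity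
    linarith
  · push Not at hneg
    obtain ⟨x, hx⟩ := hneg
    have hbs (n : ℕ) : birkhoffSum T (fun _ => (0 : ℝ)) n x = 0 := by simp [birkhoffSum]
    obtain ⟨ν, hν, hconf, hle⟩ := exists_conformal_of_sublinear_birkhoffSum (T := T) (x := x)
      (continuous_const (y := (0 : ℝ))) (fun n => (hbs n).ge)
      fun δ hδ => ⟨0, fun n => by rw [hbs]; positivity⟩
    have hνT : ν.map (T : X → X) = ν := by
      simp only [Real.exp_zero, ENNReal.ofReal_one] at hconf
      have hconf' : ν.map (T.symm : X → X) = ν := by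
        simpa using hconf
      conv_lhs => rw [← hconf']
      rw [Measure.map_map T.measurable T.symm.measurable]
      simp
    have hεν : ε ≤ ∫ y, f y ∂ν := hle f ε hf fun n => by
      rw [integral_weightedOrbitMeasure _ _ _ _ hf]
      simp only [hbs, Real.exp_zero, one_mul, sum_const, card_range, nsmul_eq_mul, mul_one]
      rw [le_div_iff₀ (by positivity)]
      have h := hx (n + 1)
      rw [hsum] at h
      exact sub_nonneg.1 h
    rw [huniq ν hν hνT, hint] at hεν
    exact absurd hεν hε.not_ge

end

/-- For a uniquely ergodic homeomorphism `T` of a nonempty compact metric space `X`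
with unique invariant probability measure `μ`, and any continuous potential `φ` with
`∫ φ dμ = 0`, there exists a `φ`-conformal Borel probability measure `ν`, i.e. one
satisfying `(T⁻¹)_* ν = e^φ · ν`. -/
theorem exists_conformal_measure_of_uniquelyErgodic
    {X : Type*} [MetricSpace X] [CompactSpace X] [Nonempty X]
    [MeasurableSpace X] [BorelSpace X]
    (T : X ≃ₜ X) (μ : Measure X) [IsProbabilityMeasure μ]
    (hinv : μ.map (T : X → X) = μ)
    (huniq : ∀ μ' : Measure X, IsProbabilityMeasure μ' → μ'.map (T : X → X) = μ' → μ' = μ)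
    (φ : X → ℝ) (hφ : Continuous φ) (hint : ∫ x, φ x ∂μ = 0) :
    ∃ ν : Measure X, IsProbabilityMeasure ν ∧
      ν.map (T.symm : X → X) = ν.withDensity fun x => ENNReal.ofReal (Real.exp (φ x)) := by
  obtain ⟨x, hx⟩ := exists_forall_birkhoffSum_nonneg T.continuous hinv hφ hint.ge
  obtain ⟨ν, hν, hconf, -⟩ := exists_conformal_of_sublinear_birkhoffSum hφ hx fun ε hε =>
    (exists_forall_birkhoffSum_le_add_of_uniquelyErgodic huniq hφ hint hε).imp
      fun _ h n => h n x
  exact ⟨ν, hν, hconf⟩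
end

section
/- In the conformal renormalization framework, suppose the renormalization map R_μ : (X^θ, μ^θ) → (X^θ, μ^θ) is ergodic; suppose ν is the unique ψ-conformal Borel probability measure for T, where ψ := log d((T⁻¹)_*ν)/dν is constant on each atom of 𝒫 and satisfies the perfect-scaling condition ψ_A∘R⁻¹ = ψ; and suppose μ and ν give positive measure to every atom of 𝒫 and of 𝒫^{(1)}, and that some atom of 𝒫 contains at least two distinct atoms of 𝒫^{(1)}. Then for μ-almost every x ∈ X, the limit lim_{n→∞} −(1/n)·log ν(P^{(n)}(x)) exists and equals H := −Σ_{α∈𝒜} Σ_{0≤i<q_α} log( ν(Tⁱ(R⁻¹P_α)) / ν(P_{β(α,i)}) )·θ_{α,i}, where θ_{α,i} = ∫_{Tⁱ(R⁻¹P_α)} θ dμ. Moreover H = −Σ_{α∈𝒜} Σ_{0≤i<q_α} log( ν(Tⁱ(R⁻¹P_α)) / ν(P_α) )·θ_{α,i}, one has H > 0, and if ν is additionally T-invariant then H = −log ν(A). -/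
open MeasureTheory Filter
open scoped ENNReal

/-- The conformal renormalization framework: a compact metric space `X`, a Borel
bijection `T` with a `φ`-conformal probability measure `μ`, a sweeping-out set `A`
with first-return time `rA`, a rescaling `R : A → X` intertwining `T` with the
first-return map and renormalizing `μ` and `φ`, a positive roof function `θ`
renormalized by the factor `e^{ρ_μ} = μ(A)⁻¹`, a finite Borel partition
`𝒫 = (P α)_{α ∈ 𝒜}` with return times `q α` on `R⁻¹ P_α ⊆ A_{q_α}` and itinerary map
`βm`, together with the refining dynamical partitions `𝒫^{(n)}` (with atoms
`Tⁱ(R⁻ⁿ P_α)`, `i < qn n α`, and atom function `Pn`). -/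
structure CRF (X : Type*) [MetricSpace X] [CompactSpace X] [MeasurableSpace X]
    [BorelSpace X] (𝒜 : Type*) [Fintype 𝒜] where
  T : X → X
  Tinv : X → X
  hT_left : Function.LeftInverse Tinv T
  hT_right : Function.RightInverse Tinv T
  hT_meas : Measurable T
  hTinv_meas : Measurable Tinv
  φ : X → ℝ
  hφ_meas : Measurable φ
  μ : Measure X
  hμ_prob : IsProbabilityMeasure μ
  hμ_conf : μ.map Tinv = μ.withDensity fun x => ENNReal.ofReal (Real.exp (φ x))
  A : Set X
  hA_meas : MeasurableSet A
  hA_cover₁ : (⋃ n : ℕ, (T^[n]) ⁻¹' A) = Set.univ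
  hA_cover₂ : (⋃ n : ℕ, (T^[n]) '' A) = Set.univ
  hμA_pos : 0 < μ A
  hμA_lt : μ A < 1
  rA : X → ℕ
  hrA_pos : ∀ x ∈ A, 1 ≤ rA x
  hrA_mem : ∀ x ∈ A, T^[rA x] x ∈ A
  hrA_min : ∀ x ∈ A, ∀ k, 1 ≤ k → k < rA x → T^[k] x ∉ A
  nA : X → ℕ
  hnA_mem : ∀ x, Tinv^[nA x] x ∈ A
  hnA_min : ∀ x, ∀ k < nA x, Tinv^[k] x ∉ A
  R : X → X
  Rinv : X → X
  hR_meas : Measurable R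
  hRinv_meas : Measurable Rinv
  hRinv_A : ∀ y, Rinv y ∈ A
  hR_Rinv : ∀ y, R (Rinv y) = y
  hRinv_R : ∀ x ∈ A, Rinv (R x) = x
  hTR : ∀ x ∈ A, T (R x) = R (T^[rA x] x)
  hφR : ∀ x ∈ A, φ (R x) = ∑ i ∈ Finset.range (rA x), φ (T^[i] x)
  hR_push : (μ.restrict A).map R = μ A • μ
  θ : X → ℝ
  hθ_meas : Measurable θ
  hθ_pos : ∀ x, 0 < θ x
  hθ_int : ∫ x, θ x ∂μ = 1
  hθA : ∀ x ∈ A,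
    (∑ i ∈ Finset.range (rA x),
        Real.exp (∑ j ∈ Finset.range i, φ (T^[j] x)) * θ (T^[i] x))
      = Real.exp (-Real.log ((μ A).toReal)) * θ (R x)
  P : 𝒜 → Set X
  hP_meas : ∀ α, MeasurableSet (P α)
  hP_disj : ∀ α β, α ≠ β → Disjoint (P α) (P β)
  hP_cover : (⋃ α, P α) = Set.univ
  q : 𝒜 → ℕ
  hq_pos : ∀ α, 1 ≤ q α
  hq_ret : ∀ α, ∀ x ∈ A, R x ∈ P α → rA x = q α
  βm : 𝒜 → ℕ → 𝒜
  hβm : ∀ α, ∀ i < q α, ∀ x ∈ A, R x ∈ P α → T^[i] x ∈ P (βm α i)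
  qn : ℕ → 𝒜 → ℕ
  hqn_pos : ∀ n, 1 ≤ n → ∀ α, 1 ≤ qn n α
  hqn_ret : ∀ n, 1 ≤ n → ∀ α, ∀ y ∈ P α,
    T^[qn n α] (Rinv^[n] y) ∈ Rinv^[n] '' Set.univ
  hqn_min : ∀ n, 1 ≤ n → ∀ α, ∀ y ∈ P α, ∀ k, 1 ≤ k → k < qn n α →
    T^[k] (Rinv^[n] y) ∉ Rinv^[n] '' Set.univ
  Pn : ℕ → X → Set X
  hPn0 : ∀ α, ∀ x ∈ P α, Pn 0 x = P α
  hPn_mem : ∀ n x, x ∈ Pn n x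
  hPn_atom : ∀ n, 1 ≤ n → ∀ α, ∀ i < qn n α,
    ∀ z ∈ (fun y => T^[i] y) '' (Rinv^[n] '' P α),
      Pn n z = (fun y => T^[i] y) '' (Rinv^[n] '' P α)
  hPn_cover : ∀ n, 1 ≤ n → ∀ z : X, ∃ α, ∃ i < qn n α,
    z ∈ (fun y => T^[i] y) '' (Rinv^[n] '' P α)

namespace CRF

variable {X : Type*} [MetricSpace X] [CompactSpace X] [MeasurableSpace X] [BorelSpace X]
variable {𝒜 : Type*} [Fintype 𝒜]

/-- `ρ_μ = -log μ(A)`. -/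
noncomputable def ρμ (F : CRF X 𝒜) : ℝ := -Real.log ((F.μ F.A).toReal)

/-- Birkhoff sums `S_n φ(x)`. -/
noncomputable def birk (F : CRF X 𝒜) (n : ℕ) (x : X) : ℝ :=
  ∑ i ∈ Finset.range n, F.φ (F.T^[i] x)

/-- Twisted Birkhoff sums `S_n^φ θ(x)`. -/
noncomputable def birkθ (F : CRF X 𝒜) (n : ℕ) (x : X) : ℝ :=
  ∑ i ∈ Finset.range n, Real.exp (F.birk i x) * F.θ (F.T^[i] x)

/-- The suspension set `X^θ = {(x,r) : 0 ≤ r < θ(x)}`. -/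
def Xθ (F : CRF X 𝒜) : Set (X × ℝ) := {p | 0 ≤ p.2 ∧ p.2 < F.θ p.1}

/-- The suspension measure `μ^θ`, the restriction of `μ ⊗ Leb` to `X^θ`. -/
noncomputable def μθ (F : CRF X 𝒜) : Measure (X × ℝ) :=
  (F.μ.prod volume).restrict F.Xθ

/-- The renormalization map `R_μ : X^θ → X^θ`,
`R_μ(x,r) = (R(T⁻ⁱ x), e^{-ρ_μ}(e^{S_i φ(T⁻ⁱ x)} r + S_i^φ θ(T⁻ⁱ x)))` with `i = n_A(x)`. -/
noncomputable def Rμ (F : CRF X 𝒜) (p : X × ℝ) : X × ℝ :=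
  (F.R (F.Tinv^[F.nA p.1] p.1),
    Real.exp (-F.ρμ) *
      (Real.exp (F.birk (F.nA p.1) (F.Tinv^[F.nA p.1] p.1)) * p.2 +
        F.birkθ (F.nA p.1) (F.Tinv^[F.nA p.1] p.1)))

/-- Ergodicity of the renormalization map `R_μ` with respect to `μ^θ`. -/
def RμErgodic (F : CRF X 𝒜) : Prop :=
  ∀ B : Set (X × ℝ), MeasurableSet B →
    F.μθ (symmDiff B (F.Rμ ⁻¹' B)) = 0 → F.μθ B = 0 ∨ F.μθ B = 1

/-- The atom `Tⁱ(R⁻¹ P_α)` of the partition `𝒫^{(1)}`. -/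
def atom1 (F : CRF X 𝒜) (α : 𝒜) (i : ℕ) : Set X :=
  (fun y => F.T^[i] y) '' (F.Rinv '' F.P α)

/-- The rescaled domain `X^{(n)} = R⁻ⁿ X`. -/
def Xdom (F : CRF X 𝒜) (n : ℕ) : Set X := F.Rinv^[n] '' Set.univ

end CRF

namespace CRF

variable {X : Type*} [MetricSpace X] [CompactSpace X] [MeasurableSpace X] [BorelSpace X]
variable {𝒜 : Type*} [Fintype 𝒜]

/-- `H^u_ν(R_μ) = -Σ_α Σ_{0 ≤ i < q_α} log(ν(Tⁱ R⁻¹P_α)/ν(P_{β(α,i)})) · θ_{α,i}`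
with `θ_{α,i} = ∫_{Tⁱ R⁻¹P_α} θ dμ`. -/
noncomputable def Hu (F : CRF X 𝒜) (ν : Measure X) : ℝ :=
  -∑ α : 𝒜, ∑ i ∈ Finset.range (F.q α),
    Real.log (((ν (F.atom1 α i)).toReal) / ((ν (F.P (F.βm α i))).toReal)) *
      ∫ x in F.atom1 α i, F.θ x ∂F.μ

end CRF

section PointwiseErgodic

variable {Y : Type*} {f : Y → Y} {g : Y → ℝ}

/-- The maximum of the Birkhoff sums of `g` along `f` over the times `0, …, n`. -/
noncomputable def birkhoffMax (f : Y → Y) (g : Y → ℝ) : ℕ → Y → ℝ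
  | 0, _ => 0
  | n + 1, x => max 0 (g x + birkhoffMax f g n (f x))

theorem birkhoffMax_nonneg (n : ℕ) (x : Y) : 0 ≤ birkhoffMax f g n x := by
  cases n with
  | zero => exact le_rfl
  | succ n => exact le_max_left _ _

theorem birkhoffMax_le_succ (n : ℕ) (x : Y) :
    birkhoffMax f g n x ≤ birkhoffMax f g (n + 1) x := by
  induction n generalizing x with
  | zero => exact birkhoffMax_nonneg 1 x
  | succ n ih => exact max_le_max le_rfl (add_le_add le_rfl (ih (f x)))

theorem birkhoffMax_mono (x : Y) : Monotone fun n => birkhoffMax f g n x :=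
  monotone_nat_of_le_succ fun n => birkhoffMax_le_succ n x

theorem birkhoffSum_le_birkhoffMax (n : ℕ) (x : Y) :
    birkhoffSum f g n x ≤ birkhoffMax f g n x := by
  induction n generalizing x with
  | zero => simp [birkhoffMax]
  | succ n ih =>
    rw [birkhoffSum_succ']
    exact (add_le_add le_rfl (ih (f x))).trans (le_max_right _ _)

theorem birkhoffMax_succ_sub (n : ℕ) (x : Y) :
    birkhoffMax f g (n + 1) x - birkhoffMax f g n (f x)
      = max (-birkhoffMax f g n (f x)) (g x) := by
  simp only [birkhoffMax]
  rw [← max_sub_sub_right]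
  congr 1 <;> ring

variable [MeasurableSpace Y] {μ : Measure Y}

theorem measurable_birkhoffMax (hf : Measurable f) (hg : Measurable g) (n : ℕ) :
    Measurable (birkhoffMax f g n) := by
  induction n with
  | zero => exact measurable_const
  | succ n ih => exact measurable_const.max (hg.add (ih.comp hf))

theorem integrable_birkhoffMax [IsFiniteMeasure μ] (hf : MeasurePreserving f μ μ)
    (hg : Integrable g μ) (n : ℕ) : Integrable (birkhoffMax f g n) μ := by
  induction n with
  | zero => exact integrable_zero _ _ _
  | succ n ih => exact (integrable_zero _ _ _).sup (hg.add (hf.integrable_comp_of_integrable ih))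

/-- If the Birkhoff maxima are almost surely unbounded, the observable has nonnegative mean. -/
theorem integral_nonneg_of_birkhoffMax_unbounded [IsFiniteMeasure μ]
    (hf : MeasurePreserving f μ μ) (hg : Integrable g μ)
    (hunb : ∀ᵐ x ∂μ, ∀ C : ℕ, ∃ n, (C : ℝ) ≤ birkhoffMax f g n x) : 0 ≤ ∫ x, g x ∂μ := by
  have hint := integrable_birkhoffMax hf hg
  have hcomp (n : ℕ) : Integrable (fun x => birkhoffMax f g n (f x)) μ :=
    hf.integrable_comp_of_integrable (hint n)
  have hlim : Tendsto
      (fun n => ∫ x, (birkhoffMax f g (n + 1) x - birkhoffMax f g n (f x)) ∂μ)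
      atTop (nhds (∫ x, g x ∂μ)) := by
    refine tendsto_integral_of_dominated_convergence (fun x => |g x|)
      (fun n => ((hint (n + 1)).sub (hcomp n)).aestronglyMeasurable) hg.abs ?_ ?_
    · refine fun n => Eventually.of_forall fun x => ?_
      rw [birkhoffMax_succ_sub, Real.norm_eq_abs, abs_le]
      have := birkhoffMax_nonneg (f := f) (g := g) n (f x)
      exact ⟨(neg_abs_le _).trans (le_max_right _ _),
        max_le (by linarith [abs_nonneg (g x)]) (le_abs_self _)⟩
    · filter_upwards [hf.quasiMeasurePreserving.ae hunb] with x hx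
      obtain ⟨C, hC⟩ := exists_nat_ge (-g x)
      obtain ⟨N, hN⟩ := hx C
      refine tendsto_const_nhds.congr' ?_
      filter_upwards [eventually_ge_atTop N] with n hn
      have := birkhoffMax_mono (f := f) (g := g) (f x) hn
      simp only at this
      rw [birkhoffMax_succ_sub, max_eq_right (by linarith)]
  refine ge_of_tendsto' hlim fun n => ?_
  rw [integral_sub (hint _) (hcomp n), sub_nonneg]
  have : ∫ x, birkhoffMax f g n (f x) ∂μ = ∫ x, birkhoffMax f g n x ∂μ := by
    rw [← integral_map (f := birkhoffMax f g n) hf.aemeasurable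
      (by rw [hf.map_eq]; exact (hint n).aestronglyMeasurable), hf.map_eq]
  rw [this]
  exact integral_mono (hint n) (hint (n + 1)) fun x => birkhoffMax_le_succ n x

theorem Ergodic.ae_birkhoffSum_bddAbove [IsProbabilityMeasure μ] (hf : Ergodic f μ)
    (hgm : Measurable g) (hg : Integrable g μ) (hneg : ∫ x, g x ∂μ < 0) :
    ∀ᵐ x ∂μ, ∃ C : ℝ, ∀ n, birkhoffSum f g n x ≤ C := by
  set E : Set Y := {x | ∀ C : ℕ, ∃ n, (C : ℝ) ≤ birkhoffMax f g n x} with hE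
  have hEm : MeasurableSet E := by
    simp only [hE, Set.ofPred_forall, Set.ofPred_exists]
    exact MeasurableSet.iInter fun C => MeasurableSet.iUnion fun n =>
      measurableSet_le measurable_const (measurable_birkhoffMax hf.measurable hgm n)
  have hEinv : f ⁻¹' E = E := by
    ext x
    refine ⟨fun h C => ?_, fun h C => ?_⟩
    · obtain ⟨D, hD⟩ := exists_nat_ge (C - g x)
      obtain ⟨n, hn⟩ := h D
      refine ⟨n + 1, le_trans ?_ (le_max_right _ _)⟩
      linarith
    · obtain ⟨D, hD⟩ := exists_nat_ge (C + |g x|)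
      obtain ⟨n, hn⟩ := h D
      refine ⟨n, ?_⟩
      have h1 := hn.trans (birkhoffMax_le_succ n x)
      have h2 : birkhoffMax f g (n + 1) x ≤ |g x| + birkhoffMax f g n (f x) :=
        max_le (add_nonneg (abs_nonneg _) (birkhoffMax_nonneg _ _))
          (add_le_add (le_abs_self _) le_rfl)
      linarith
  rcases hf.toPreErgodic.prob_eq_zero_or_one hEm hEinv with h0 | h1
  · filter_upwards [measure_eq_zero_iff_ae_notMem.1 h0] with x hx
    simp only [hE, Set.mem_ofPred_eq, not_forall, not_exists, not_le] at hx
    obtain ⟨C, hC⟩ := hx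
    exact ⟨C, fun n => (birkhoffSum_le_birkhoffMax n x).trans (hC n).le⟩
  · have hae : ∀ᵐ x ∂μ, x ∈ E := (mem_ae_iff_prob_eq_one hEm).2 h1
    exact absurd (integral_nonneg_of_birkhoffMax_unbounded hf.toMeasurePreserving hg hae)
      (not_le.2 hneg)

theorem Ergodic.ae_eventually_birkhoffSum_div_lt [IsProbabilityMeasure μ] (hf : Ergodic f μ)
    (hgm : Measurable g) (hg : Integrable g μ) {ε : ℝ} (hε : 0 < ε) :
    ∀ᵐ x ∂μ, ∀ᶠ n : ℕ in atTop, birkhoffSum f g n x / n < ∫ x, g x ∂μ + ε := by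
  set c := ∫ x, g x ∂μ + ε / 2 with hc
  have key := hf.ae_birkhoffSum_bddAbove (g := fun x => g x - c) (hgm.sub measurable_const)
    (hg.sub (integrable_const c)) (by
      rw [integral_sub hg (integrable_const c)]; simp [hc]; linarith)
  filter_upwards [key] with x ⟨C, hC⟩
  filter_upwards [eventually_gt_atTop 0, eventually_gt_atTop ⌈2 * C / ε⌉₊] with n hn0 hn
  have hn0' : (0 : ℝ) < n := by exact_mod_cast hn0
  have hn' : 2 * C / ε < n := (Nat.le_ceil _).trans_lt (by exact_mod_cast hn)
  rw [div_lt_iff₀ hε] at hn'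
  have h := hC n
  simp only [birkhoffSum, Finset.sum_sub_distrib, Finset.sum_const, Finset.card_range,
    nsmul_eq_mul] at h
  rw [div_lt_iff₀ hn0', birkhoffSum]
  rw [hc] at h
  nlinarith

/-- Birkhoff's pointwise ergodic theorem for an ergodic transformation. -/
theorem Ergodic.ae_tendsto_birkhoffSum_div [IsProbabilityMeasure μ] (hf : Ergodic f μ)
    (hgm : Measurable g) (hg : Integrable g μ) :
    ∀ᵐ x ∂μ, Tendsto (fun n : ℕ => birkhoffSum f g n x / n) atTop (nhds (∫ x, g x ∂μ)) := by
  have hup := fun m : ℕ => hf.ae_eventually_birkhoffSum_div_lt hgm hg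
    (Nat.one_div_pos_of_nat (α := ℝ) (n := m))
  have hlo := fun m : ℕ => hf.ae_eventually_birkhoffSum_div_lt hgm.neg hg.neg
    (Nat.one_div_pos_of_nat (α := ℝ) (n := m))
  filter_upwards [ae_all_iff.2 hup, ae_all_iff.2 hlo] with x hx hx'
  rw [Metric.tendsto_nhds]
  intro ε hε
  obtain ⟨m, hm⟩ := exists_nat_one_div_lt hε
  filter_upwards [hx m, hx' m] with n h1 h2
  simp only [birkhoffSum, Pi.neg_apply, Finset.sum_neg_distrib, integral_neg, neg_div] at h1 h2
  rw [Real.dist_eq, abs_lt]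
  simp only [birkhoffSum]
  constructor <;> linarith

end PointwiseErgodic

theorem exists_sum_range_add_lt (s : ℕ → ℕ) (N k : ℕ) (hk : k < ∑ j ∈ Finset.range N, s j) :
    ∃ j < N, ∃ i < s j, k = i + ∑ l ∈ Finset.range j, s l := by
  induction N with
  | zero => simp at hk
  | succ N ih =>
    by_cases h : k < ∑ j ∈ Finset.range N, s j
    · obtain ⟨j, hj, hi⟩ := ih h
      exact ⟨j, hj.trans (Nat.lt_succ_self N), hi⟩
    · rw [Finset.sum_range_succ] at hk
      exact ⟨N, Nat.lt_succ_self N, k - ∑ j ∈ Finset.range N, s j, by omega, by omega⟩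

theorem lintegral_Ico_sum_range (b : ℕ → ℝ) (hb : Monotone b) (h : ℝ → ℝ≥0∞) (n : ℕ) :
    ∑ i ∈ Finset.range n, ∫⁻ s in Set.Ico (b i) (b (i + 1)), h s
      = ∫⁻ s in Set.Ico (b 0) (b n), h s := by
  induction n with
  | zero => simp
  | succ n ih =>
    rw [Finset.sum_range_succ, ih,
      ← Set.Ico_union_Ico_eq_Ico (hb (Nat.zero_le n)) (hb (Nat.le_succ n)),
      lintegral_union measurableSet_Ico]
    rw [Set.disjoint_left]
    exact fun x hx hx' => absurd hx.2 (not_lt.2 hx'.1)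

theorem lintegral_Ico_comp_affine {a : ℝ} (ha : 0 < a) (b t : ℝ) {h : ℝ → ℝ≥0∞}
    (hh : Measurable h) :
    ENNReal.ofReal a * ∫⁻ r in Set.Ico 0 t, h (a * r + b)
      = ∫⁻ s in Set.Ico b (a * t + b), h s := by
  have himg : (fun r => a * r + b) '' Set.Ico 0 t = Set.Ico b (a * t + b) := by
    rw [Set.image_affine_Ico ha]
    simp
  rw [← himg, lintegral_image_eq_lintegral_abs_deriv_mul measurableSet_Ico (f' := fun _ => a)
    (fun x _ => by
      simpa using (((hasDerivAt_id x).const_mul a).add_const b).hasDerivWithinAt)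
    (fun x _ y _ hxy => by simpa [ha.ne'] using hxy), abs_of_pos ha,
    lintegral_const_mul]
  exact hh.comp (by fun_prop)

namespace CRF

variable {X : Type*} [MetricSpace X] [CompactSpace X] [MeasurableSpace X] [BorelSpace X]
variable {𝒜 : Type*} [Fintype 𝒜] (F : CRF X 𝒜)

/-- The base map `x ↦ R(T⁻ⁱ x)`, `i = n_A(x)`, of the renormalization map. -/
def renormBase (x : X) : X := F.R (F.Tinv^[F.nA x] x)

theorem exists_mem_P (x : X) : ∃ α, x ∈ F.P α := by
  have h := Set.mem_univ x
  rw [← F.hP_cover] at h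
  exact Set.mem_iUnion.1 h

theorem eq_of_mem_P {x : X} {α β : 𝒜} (hα : x ∈ F.P α) (hβ : x ∈ F.P β) : α = β := by
  by_contra h
  exact Set.disjoint_left.1 (F.hP_disj α β h) hα hβ

theorem Tinv_iterate_T (n : ℕ) (x : X) : F.Tinv^[n] (F.T^[n] x) = x :=
  F.hT_left.iterate n x

theorem T_iterate_Tinv (n : ℕ) (x : X) : F.T^[n] (F.Tinv^[n] x) = x :=
  F.hT_right.iterate n x

theorem Tinv_iterate_T_add (n k : ℕ) (x : X) : F.Tinv^[k] (F.T^[k + n] x) = F.T^[n] x := by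
  rw [Function.iterate_add_apply, F.Tinv_iterate_T]

theorem rA_Rinv {α : 𝒜} {z : X} (hz : z ∈ F.P α) : F.rA (F.Rinv z) = F.q α :=
  F.hq_ret α _ (F.hRinv_A z) ((F.hR_Rinv z).symm ▸ hz)

theorem T_iterate_Rinv_mem_P {α : 𝒜} {z : X} (hz : z ∈ F.P α) {i : ℕ} (hi : i < F.q α) :
    F.T^[i] (F.Rinv z) ∈ F.P (F.βm α i) :=
  F.hβm α i hi _ (F.hRinv_A z) ((F.hR_Rinv z).symm ▸ hz)

theorem Rinv_T {α : 𝒜} {z : X} (hz : z ∈ F.P α) :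
    F.Rinv (F.T z) = F.T^[F.q α] (F.Rinv z) := by
  have h := F.hTR _ (F.hRinv_A z)
  rw [F.hR_Rinv] at h
  rw [h, F.hRinv_R _ (F.hrA_mem _ (F.hRinv_A z)), F.rA_Rinv hz]

theorem nA_T_iterate {a : X} (ha : a ∈ F.A) {i : ℕ} (hi : i < F.rA a) :
    F.nA (F.T^[i] a) = i := by
  have key : ∀ k < i, F.Tinv^[k] (F.T^[i] a) ∉ F.A := by
    intro k hk
    obtain ⟨j, rfl⟩ : ∃ j, i = k + j := ⟨i - k, by omega⟩
    rw [F.Tinv_iterate_T_add]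
    exact F.hrA_min a ha j (by omega) (by omega)
  rcases lt_trichotomy (F.nA (F.T^[i] a)) i with h | h | h
  · exact absurd (F.hnA_mem _) (key _ h)
  · exact h
  · exact absurd (by rwa [F.Tinv_iterate_T]) (F.hnA_min _ _ h)

theorem nA_lt_rA (x : X) : F.nA x < F.rA (F.Tinv^[F.nA x] x) := by
  by_contra! h
  have hr := F.hrA_mem _ (F.hnA_mem x)
  have h1 := F.hrA_pos _ (F.hnA_mem x)
  obtain ⟨j, hj⟩ : ∃ j, F.nA x = F.rA (F.Tinv^[F.nA x] x) + j := ⟨_, (Nat.add_sub_of_le h).symm⟩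
  refine F.hnA_min x j (by omega) ?_
  generalize F.rA (F.Tinv^[F.nA x] x) = r at *
  rwa [hj, Function.iterate_add_apply, F.T_iterate_Tinv] at hr

theorem Rinv_renormBase (x : X) : F.Rinv (F.renormBase x) = F.Tinv^[F.nA x] x :=
  F.hRinv_R _ (F.hnA_mem x)

theorem T_iterate_Rinv_renormBase (x : X) : F.T^[F.nA x] (F.Rinv (F.renormBase x)) = x := by
  rw [Rinv_renormBase, T_iterate_Tinv]

theorem nA_lt_q {x : X} {α : 𝒜} (h : F.renormBase x ∈ F.P α) : F.nA x < F.q α := by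
  rw [← F.rA_Rinv h, Rinv_renormBase]
  exact F.nA_lt_rA x

theorem nA_T_iterate_Rinv {α : 𝒜} {z : X} (hz : z ∈ F.P α) {i : ℕ} (hi : i < F.q α) :
    F.nA (F.T^[i] (F.Rinv z)) = i :=
  F.nA_T_iterate (F.hRinv_A z) (by rwa [F.rA_Rinv hz])

theorem renormBase_T_iterate_Rinv {α : 𝒜} {z : X} (hz : z ∈ F.P α) {i : ℕ} (hi : i < F.q α) :
    F.renormBase (F.T^[i] (F.Rinv z)) = z := by
  rw [renormBase, F.nA_T_iterate_Rinv hz hi, Tinv_iterate_T, F.hR_Rinv]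

theorem mem_atom1_iff {α : 𝒜} {i : ℕ} (hi : i < F.q α) {x : X} :
    x ∈ F.atom1 α i ↔ F.renormBase x ∈ F.P α ∧ F.nA x = i := by
  constructor
  · rintro ⟨_, ⟨z, hz, rfl⟩, rfl⟩
    exact ⟨(F.renormBase_T_iterate_Rinv hz hi).symm ▸ hz, F.nA_T_iterate_Rinv hz hi⟩
  · rintro ⟨h, rfl⟩
    exact ⟨_, ⟨_, h, rfl⟩, F.T_iterate_Rinv_renormBase x⟩

theorem atom1_subset {α : 𝒜} {i : ℕ} (hi : i < F.q α) : F.atom1 α i ⊆ F.P (F.βm α i) := by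
  rintro _ ⟨_, ⟨z, hz, rfl⟩, rfl⟩
  exact F.T_iterate_Rinv_mem_P hz hi

/-- The return time of `R⁻ⁿ P_α` to `R⁻ⁿ X`, including `n = 0`. -/
def returnTime (n : ℕ) (α : 𝒜) : ℕ := if n = 0 then 1 else F.qn n α

theorem returnTime_zero (α : 𝒜) : F.returnTime 0 α = 1 := if_pos rfl

theorem returnTime_pos (n : ℕ) (α : 𝒜) : 1 ≤ F.returnTime n α := by
  unfold returnTime
  split_ifs with h
  · exact le_rfl
  · exact F.hqn_pos n (by omega) α

theorem returnTime_mem (n : ℕ) {α : 𝒜} {y : X} (hy : y ∈ F.P α) :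
    F.T^[F.returnTime n α] (F.Rinv^[n] y) ∈ F.Xdom n := by
  unfold returnTime
  split_ifs with h
  · subst h
    exact ⟨_, trivial, rfl⟩
  · exact F.hqn_ret n (by omega) α y hy

theorem returnTime_min (n : ℕ) {α : 𝒜} {y : X} (hy : y ∈ F.P α) {k : ℕ} (hk : 1 ≤ k)
    (hk' : k < F.returnTime n α) : F.T^[k] (F.Rinv^[n] y) ∉ F.Xdom n := by
  unfold returnTime at hk'
  split_ifs at hk' with h
  · omega
  · exact F.hqn_min n (by omega) α y hy k hk hk'

theorem returnTime_eq (n : ℕ) {α : 𝒜} {y : X} (hy : y ∈ F.P α) {N : ℕ} (hN : 1 ≤ N)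
    (hmem : F.T^[N] (F.Rinv^[n] y) ∈ F.Xdom n)
    (hmin : ∀ k, 1 ≤ k → k < N → F.T^[k] (F.Rinv^[n] y) ∉ F.Xdom n) :
    F.returnTime n α = N := by
  rcases lt_trichotomy (F.returnTime n α) N with h | h | h
  · exact absurd (F.returnTime_mem n hy) (hmin _ (F.returnTime_pos n α) h)
  · exact h
  · exact absurd hmem (F.returnTime_min n hy hN h)

theorem mem_Xdom_succ {n : ℕ} {x : X} :
    x ∈ F.Xdom (n + 1) ↔ ∃ z ∈ F.Xdom n, F.Rinv z = x := by
  constructor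
  · rintro ⟨y, -, rfl⟩
    exact ⟨_, ⟨y, trivial, rfl⟩, (Function.iterate_succ_apply' _ _ _).symm⟩
  · rintro ⟨_, ⟨y, -, rfl⟩, rfl⟩
    exact ⟨y, trivial, Function.iterate_succ_apply' _ _ _⟩

theorem Rinv_T_iterate {γ : ℕ → 𝒜} {w : X} {N : ℕ} (hγ : ∀ k < N, F.T^[k] w ∈ F.P (γ k)) :
    F.Rinv (F.T^[N] w) = F.T^[∑ l ∈ Finset.range N, F.q (γ l)] (F.Rinv w) := by
  induction N with
  | zero => rfl
  | succ N ih =>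
    rw [Function.iterate_succ_apply', F.Rinv_T (hγ N (Nat.lt_succ_self N)),
      ih fun k hk => hγ k (hk.trans (Nat.lt_succ_self N)), Finset.sum_range_succ, add_comm,
      Function.iterate_add_apply]

/-- The return time to `R⁻ⁿ⁻¹ X` is the sum of the return times to `A` along an itinerary. -/
theorem returnTime_succ (n : ℕ) {α : 𝒜} {y : X} (hy : y ∈ F.P α) {γ : ℕ → 𝒜}
    (hγ : ∀ k < F.returnTime n α, F.T^[k] (F.Rinv^[n] y) ∈ F.P (γ k)) :
    F.returnTime (n + 1) α = ∑ l ∈ Finset.range (F.returnTime n α), F.q (γ l) := by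
  refine F.returnTime_eq (n + 1) hy ?_ ?_ ?_
  · refine (F.hq_pos (γ 0)).trans (Finset.single_le_sum (f := fun l => F.q (γ l))
      (fun _ _ => Nat.zero_le _) (Finset.mem_range.2 (F.returnTime_pos n α)))
  · rw [Function.iterate_succ_apply', ← F.Rinv_T_iterate hγ]
    exact F.mem_Xdom_succ.2 ⟨_, F.returnTime_mem n hy, rfl⟩
  · intro k hk1 hk hmem
    obtain ⟨j, hj, i, hi, rfl⟩ := exists_sum_range_add_lt _ _ _ hk
    have hγj := hγ j hj
    rw [Function.iterate_succ_apply', Function.iterate_add_apply,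
      ← F.Rinv_T_iterate fun k hk => hγ k (hk.trans hj)] at hmem
    obtain ⟨z, hz, hzeq⟩ := F.mem_Xdom_succ.1 hmem
    have hi0 : i = 0 := by
      by_contra h0
      refine F.hrA_min _ (F.hRinv_A _) i (by omega) ?_ (hzeq ▸ F.hRinv_A z)
      rwa [F.rA_Rinv hγj]
    subst hi0
    have hzj : z = F.T^[j] (F.Rinv^[n] y) := by
      simpa [F.hR_Rinv] using congrArg F.R hzeq
    have hj1 : 1 ≤ j := by
      by_contra h0
      obtain rfl : j = 0 := by omega
      simp at hk1
    exact F.returnTime_min n hy hj1 hj (hzj ▸ hz)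

/-- All points of `R⁻ⁿ P_α` have the same `𝒫`-itinerary until their return to `R⁻ⁿ X`. -/
theorem exists_itinerary (n : ℕ) (α : 𝒜) : ∃ γ : ℕ → 𝒜, ∀ k < F.returnTime n α,
    ∀ y ∈ F.P α, F.T^[k] (F.Rinv^[n] y) ∈ F.P (γ k) := by
  induction n with
  | zero =>
    refine ⟨fun _ => α, fun k hk y hy => ?_⟩
    rw [returnTime_zero, Nat.lt_one_iff] at hk
    subst hk
    exact hy
  | succ n ih =>
    obtain ⟨γ, hγ⟩ := ih
    have key : ∀ k, ∃ δ, k < F.returnTime (n + 1) α →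
        ∀ y ∈ F.P α, F.T^[k] (F.Rinv^[n + 1] y) ∈ F.P δ := by
      intro k
      by_cases hne : (F.P α).Nonempty
      · obtain ⟨y₀, hy₀⟩ := hne
        rw [F.returnTime_succ n hy₀ fun k hk => hγ k hk y₀ hy₀]
        by_cases hk : k < ∑ l ∈ Finset.range (F.returnTime n α), F.q (γ l)
        · obtain ⟨j, hj, i, hi, rfl⟩ := exists_sum_range_add_lt _ _ _ hk
          refine ⟨F.βm (γ j) i, fun _ y hy => ?_⟩
          rw [Function.iterate_succ_apply', Function.iterate_add_apply,
            ← F.Rinv_T_iterate fun k hk => hγ k (hk.trans hj) y hy]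
          exact F.T_iterate_Rinv_mem_P (hγ j hj y hy) hi
        · exact ⟨α, fun h => absurd h hk⟩
      · exact ⟨α, fun _ y hy => absurd ⟨y, hy⟩ hne⟩
    choose δ hδ using key
    exact ⟨δ, hδ⟩

theorem exists_Pn_eq (n : ℕ) (x : X) : ∃ α, ∃ j < F.returnTime n α,
    x ∈ (fun y => F.T^[j] y) '' (F.Rinv^[n] '' F.P α) ∧
      F.Pn n x = (fun y => F.T^[j] y) '' (F.Rinv^[n] '' F.P α) := by
  by_cases hn : n = 0
  · subst hn
    obtain ⟨α, hα⟩ := F.exists_mem_P x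
    refine ⟨α, 0, F.returnTime_pos 0 α, ?_, ?_⟩
    · simpa using hα
    · simpa using F.hPn0 α x hα
  · obtain ⟨α, i, hi, hx⟩ := F.hPn_cover n (by omega) x
    exact ⟨α, i, by simpa [returnTime, hn] using hi, hx, F.hPn_atom n (by omega) α i hi x hx⟩

theorem Pn_eq {n : ℕ} {α : 𝒜} {j : ℕ} (hj : j < F.returnTime n α) {x : X}
    (hx : x ∈ (fun y => F.T^[j] y) '' (F.Rinv^[n] '' F.P α)) :
    F.Pn n x = (fun y => F.T^[j] y) '' (F.Rinv^[n] '' F.P α) := by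
  by_cases hn : n = 0
  · subst hn
    rw [returnTime_zero, Nat.lt_one_iff] at hj
    subst hj
    simpa using F.hPn0 α x (by simpa using hx)
  · exact F.hPn_atom n (by omega) α j (by simpa [returnTime, hn] using hj) x hx

theorem Pn_subset_P (n : ℕ) {x : X} {α : 𝒜} (hx : x ∈ F.P α) : F.Pn n x ⊆ F.P α := by
  obtain ⟨β, j, hj, hmem, heq⟩ := F.exists_Pn_eq n x
  obtain ⟨γ, hγ⟩ := F.exists_itinerary n β
  have hsub : F.Pn n x ⊆ F.P (γ j) := by
    rw [heq]
    rintro _ ⟨_, ⟨y, hy, rfl⟩, rfl⟩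
    exact hγ j hj y hy
  rwa [F.eq_of_mem_P hx (hsub (F.hPn_mem n x))]

/-- The atoms of `𝒫^{(n+1)}` are the rescaled copies of the atoms of `𝒫^{(n)}`. -/
theorem Pn_succ (n : ℕ) (x : X) :
    F.Pn (n + 1) x
      = (fun y => F.T^[F.nA x] y) '' (F.Rinv '' F.Pn n (F.renormBase x)) := by
  obtain ⟨α, j, hj, ⟨_, ⟨y, hy, rfl⟩, hyx⟩, heq⟩ := F.exists_Pn_eq n (F.renormBase x)
  obtain ⟨γ, hγ⟩ := F.exists_itinerary n α
  simp only at hyx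
  have hi : F.nA x < F.q (γ j) := F.nA_lt_q (hyx ▸ hγ j hj y hy)
  set m := F.nA x + ∑ l ∈ Finset.range j, F.q (γ l) with hm
  have hstep : ∀ z ∈ F.P α, F.T^[m] (F.Rinv^[n + 1] z)
      = F.T^[F.nA x] (F.Rinv (F.T^[j] (F.Rinv^[n] z))) := by
    intro z hz
    rw [F.Rinv_T_iterate fun k hk => hγ k (hk.trans hj) z hz, hm, Function.iterate_add_apply,
      Function.iterate_succ_apply']
  have hmlt : m < F.returnTime (n + 1) α := by
    rw [F.returnTime_succ n hy fun k hk => hγ k hk y hy]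
    calc m < ∑ l ∈ Finset.range (j + 1), F.q (γ l) := by rw [Finset.sum_range_succ]; omega
      _ ≤ _ := Finset.sum_le_sum_of_subset (Finset.range_mono hj)
  rw [F.Pn_eq hmlt (x := x), heq]
  · simp only [Set.image_image]
    exact Set.image_congr hstep
  · refine ⟨_, ⟨y, hy, rfl⟩, ?_⟩
    simp only
    rw [hstep y hy, hyx, T_iterate_Rinv_renormBase]

theorem image_T_iterate (i : ℕ) (S : Set X) :
    (fun y => F.T^[i] y) '' S = F.Tinv^[i] ⁻¹' S :=
  congrFun (Set.image_eq_preimage_of_inverse (F.hT_left.iterate i) (F.hT_right.iterate i)) S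

theorem image_Rinv (S : Set X) : F.Rinv '' S = F.R ⁻¹' S ∩ F.A := by
  ext x
  constructor
  · rintro ⟨z, hz, rfl⟩
    exact ⟨by simpa [F.hR_Rinv] using hz, F.hRinv_A z⟩
  · rintro ⟨hx, hA⟩
    exact ⟨_, hx, F.hRinv_R x hA⟩

theorem measurableSet_image_Rinv {S : Set X} (hS : MeasurableSet S) :
    MeasurableSet (F.Rinv '' S) := by
  rw [image_Rinv]
  exact (F.hR_meas hS).inter F.hA_meas

theorem measurableSet_image_T_iterate (i : ℕ) {S : Set X} (hS : MeasurableSet S) :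
    MeasurableSet ((fun y => F.T^[i] y) '' S) := by
  rw [image_T_iterate]
  exact F.hTinv_meas.iterate i hS

theorem measurableSet_atom1 (α : 𝒜) (i : ℕ) : MeasurableSet (F.atom1 α i) :=
  F.measurableSet_image_T_iterate i (F.measurableSet_image_Rinv (F.hP_meas α))

theorem measurableSet_Pn (n : ℕ) (x : X) : MeasurableSet (F.Pn n x) := by
  induction n generalizing x with
  | zero =>
    obtain ⟨α, hα⟩ := F.exists_mem_P x
    rw [F.hPn0 α x hα]
    exact F.hP_meas α
  | succ n ih =>
    rw [Pn_succ]
    exact F.measurableSet_image_T_iterate _ (F.measurableSet_image_Rinv (ih _))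

/-- The measure `m` is scaled by `T` with the constant factor `c α` on each atom `P α`. -/
def ScaledBy (c : 𝒜 → ℝ≥0∞) (m : Measure X) : Prop :=
  ∀ α, ∀ E, MeasurableSet E → E ⊆ F.P α → m (F.Tinv ⁻¹' E) = c α * m E

section Scaling

variable {F} {c : 𝒜 → ℝ≥0∞} {m : Measure X} {ψ : X → ℝ}

theorem map_eq_withDensity_iff_scaledBy
    (hc : ∀ α, ∀ x ∈ F.P α, ENNReal.ofReal (Real.exp (ψ x)) = c α) :
    m.map F.Tinv = m.withDensity (fun x => ENNReal.ofReal (Real.exp (ψ x))) ↔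
      F.ScaledBy c m := by
  have hd : ∀ α, ∀ E, MeasurableSet E → E ⊆ F.P α →
      m.withDensity (fun x => ENNReal.ofReal (Real.exp (ψ x))) E = c α * m E := by
    intro α E hE hsub
    rw [withDensity_apply _ hE, setLIntegral_congr_fun hE fun x hx => hc α x (hsub hx),
      setLIntegral_const]
  constructor
  · intro h α E hE hsub
    rw [← hd α E hE hsub, ← h, Measure.map_apply F.hTinv_meas hE]
  · intro h
    refine Measure.ext_of_iUnion_eq_univ F.hP_cover fun α => Measure.ext fun E hE => ?_
    have hE' := hE.inter (F.hP_meas α)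
    rw [Measure.restrict_apply hE, Measure.restrict_apply hE, hd α _ hE' Set.inter_subset_right,
      Measure.map_apply F.hTinv_meas hE', h α _ hE' Set.inter_subset_right]

theorem ScaledBy.measure_image_T_iterate_Rinv (h : F.ScaledBy c m) {α : 𝒜} {E : Set X}
    (hE : MeasurableSet E) (hsub : E ⊆ F.P α) {i : ℕ} (hi : i ≤ F.q α) :
    m ((fun y => F.T^[i] y) '' (F.Rinv '' E))
      = (∏ k ∈ Finset.range i, c (F.βm α k)) * m (F.Rinv '' E) := by
  induction i with
  | zero => simp
  | succ i ih =>
    have hs : (fun y => F.T^[i] y) '' (F.Rinv '' E) ⊆ F.P (F.βm α i) := by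
      rintro _ ⟨_, ⟨z, hz, rfl⟩, rfl⟩
      exact F.T_iterate_Rinv_mem_P (hsub hz) (by omega)
    have := h _ _ (F.measurableSet_image_T_iterate i (F.measurableSet_image_Rinv hE)) hs
    rw [ih (by omega)] at this
    rw [Finset.prod_range_succ, mul_comm _ (c _), mul_assoc, ← this, image_T_iterate,
      image_T_iterate]
    rfl

theorem prod_scaling (hψ : ∀ x ∈ F.A, (∑ i ∈ Finset.range (F.rA x), ψ (F.T^[i] x)) = ψ (F.R x))
    (hc : ∀ α, ∀ x ∈ F.P α, ENNReal.ofReal (Real.exp (ψ x)) = c α) {α : 𝒜} {z : X}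
    (hz : z ∈ F.P α) : ∏ k ∈ Finset.range (F.q α), c (F.βm α k) = c α := by
  have h := hψ _ (F.hRinv_A z)
  rw [F.rA_Rinv hz, F.hR_Rinv] at h
  rw [← hc α z hz, ← h, Real.exp_sum, ENNReal.ofReal_prod_of_nonneg fun _ _ => (Real.exp_pos _).le]
  exact Finset.prod_congr rfl fun k hk =>
    (hc _ _ (F.T_iterate_Rinv_mem_P hz (Finset.mem_range.1 hk))).symm

theorem image_Rinv_image_T {α : 𝒜} {E : Set X} (hsub : E ⊆ F.P α) :
    F.Rinv '' (F.Tinv ⁻¹' E) = (fun y => F.T^[F.q α] y) '' (F.Rinv '' E) := by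
  have : F.Tinv ⁻¹' E = F.T '' E := (F.image_T_iterate 1 E).symm
  rw [this, Set.image_image, Set.image_image]
  exact Set.image_congr fun z hz => F.Rinv_T (hsub hz)

theorem map_R_restrict_apply {E : Set X} (hE : MeasurableSet E) :
    (m.restrict F.A).map F.R E = m (F.Rinv '' E) := by
  rw [Measure.map_apply F.hR_meas hE, Measure.restrict_apply (F.hR_meas hE), image_Rinv]

/-- Perfect scaling of `ψ` makes the rescaled measure `R_*(m|_A)` scale in the same way as `m`. -/
theorem ScaledBy.map_R (h : F.ScaledBy c m)
    (hprod : ∀ α, (F.P α).Nonempty → ∏ k ∈ Finset.range (F.q α), c (F.βm α k) = c α) :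
    F.ScaledBy c ((m.restrict F.A).map F.R) := by
  intro α E hE hsub
  rcases E.eq_empty_or_nonempty with rfl | hne
  · simp
  rw [map_R_restrict_apply hE, map_R_restrict_apply (F.hTinv_meas hE), image_Rinv_image_T hsub,
    h.measure_image_T_iterate_Rinv hE hsub le_rfl, hprod α (hne.mono hsub)]

theorem ScaledBy.smul (h : F.ScaledBy c m) (a : ℝ≥0∞) : F.ScaledBy c (a • m) := by
  intro α E hE hsub
  simp only [Measure.smul_apply, smul_eq_mul, h α E hE hsub]
  ring

theorem measure_image_Rinv_of_unique [IsProbabilityMeasure m] (h : F.ScaledBy c m)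
    (hprod : ∀ α, (F.P α).Nonempty → ∏ k ∈ Finset.range (F.q α), c (F.βm α k) = c α)
    (huniq : ∀ m', IsProbabilityMeasure m' → F.ScaledBy c m' → m' = m) (hA : m F.A ≠ 0)
    {E : Set X} (hE : MeasurableSet E) : m (F.Rinv '' E) = m F.A * m E := by
  have hm' : (m F.A)⁻¹ • (m.restrict F.A).map F.R = m := by
    refine huniq _ ⟨?_⟩ ((h.map_R hprod).smul _)
    rw [Measure.smul_apply, Measure.map_apply F.hR_meas MeasurableSet.univ, Set.preimage_univ,
      Measure.restrict_apply_univ, smul_eq_mul, ENNReal.inv_mul_cancel hA (measure_ne_top _ _)]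
  have h2 := congrArg (· E) hm'
  simp only [Measure.smul_apply, smul_eq_mul, map_R_restrict_apply hE] at h2
  rw [← h2, ← mul_assoc, ENNReal.mul_inv_cancel hA
    (measure_ne_top _ _), one_mul]

end Scaling

theorem measurable_birk (n : ℕ) : Measurable (F.birk n) :=
  Finset.measurable_sum _ fun i _ => F.hφ_meas.comp (F.hT_meas.iterate i)

theorem measurable_birkθ (n : ℕ) : Measurable (F.birkθ n) :=
  Finset.measurable_sum _ fun i _ => (Real.measurable_exp.comp (F.measurable_birk i)).mul
    (F.hθ_meas.comp (F.hT_meas.iterate i))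

theorem measurable_nA : Measurable F.nA := by
  refine measurable_to_countable' fun n => ?_
  have : F.nA ⁻¹' {n} = F.Tinv^[n] ⁻¹' F.A ∩ ⋂ k : ℕ, ⋂ _ : k < n, (F.Tinv^[k] ⁻¹' F.A)ᶜ := by
    ext x
    simp only [Set.mem_preimage, Set.mem_singleton_iff, Set.mem_inter_iff, Set.mem_iInter,
      Set.mem_compl_iff]
    constructor
    · rintro rfl
      exact ⟨F.hnA_mem x, F.hnA_min x⟩
    · rintro ⟨h1, h2⟩
      rcases lt_trichotomy (F.nA x) n with h | h | h
      · exact absurd (F.hnA_mem x) (h2 _ h)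
      · exact h
      · exact absurd h1 (F.hnA_min x n h)
  rw [this]
  exact (F.hTinv_meas.iterate n F.hA_meas).inter (MeasurableSet.iInter fun k =>
    MeasurableSet.iInter fun _ => (F.hTinv_meas.iterate k F.hA_meas).compl)

theorem measurable_renormBase : Measurable F.renormBase := by
  have : Measurable fun p : ℕ × X => F.R (F.Tinv^[p.1] p.2) :=
    measurable_from_prod_countable_right fun n => F.hR_meas.comp (F.hTinv_meas.iterate n)
  exact this.comp (F.measurable_nA.prodMk measurable_id)

theorem measurable_Rμ : Measurable F.Rμ := by
  have : Measurable fun q : ℕ × (X × ℝ) => Real.exp (-F.ρμ) *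
      (Real.exp (F.birk q.1 (F.Tinv^[q.1] q.2.1)) * q.2.2 +
        F.birkθ q.1 (F.Tinv^[q.1] q.2.1)) := by
    refine measurable_from_prod_countable_right fun n => ?_
    have hT : Measurable fun p : X × ℝ => F.Tinv^[n] p.1 :=
      (F.hTinv_meas.iterate n).comp measurable_fst
    exact measurable_const.mul (((Real.measurable_exp.comp
      ((F.measurable_birk n).comp hT)).mul measurable_snd).add ((F.measurable_birkθ n).comp hT))
  have h2 := this.comp ((F.measurable_nA.comp measurable_fst).prodMk
    (measurable_id (α := X × ℝ)))
  exact (F.measurable_renormBase.comp measurable_fst).prodMk h2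

theorem measurableSet_Xθ : MeasurableSet F.Xθ :=
  (measurableSet_le measurable_const measurable_snd).inter
    (measurableSet_lt measurable_snd (F.hθ_meas.comp measurable_fst))

theorem lintegral_μθ {f : X × ℝ → ℝ≥0∞} (hf : Measurable f) :
    ∫⁻ p, f p ∂F.μθ = ∫⁻ x, (∫⁻ r in Set.Ico 0 (F.θ x), f (x, r)) ∂F.μ := by
  have := F.hμ_prob
  rw [μθ, ← lintegral_indicator F.measurableSet_Xθ, lintegral_prod _
    (hf.indicator F.measurableSet_Xθ).aemeasurable]
  refine lintegral_congr fun x => ?_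
  rw [← lintegral_indicator measurableSet_Ico]
  rfl

theorem measurable_lintegral_fibre {f : X × ℝ → ℝ≥0∞} (hf : Measurable f) :
    Measurable fun x => ∫⁻ r in Set.Ico 0 (F.θ x), f (x, r) := by
  have h := (hf.indicator F.measurableSet_Xθ).lintegral_prod_right' (ν := volume)
  convert h using 2 with x
  rw [← lintegral_indicator measurableSet_Ico]
  rfl

theorem birk_succ (n : ℕ) (x : X) : F.birk (n + 1) x = F.birk n x + F.φ (F.T^[n] x) :=
  Finset.sum_range_succ _ _

theorem lintegral_comp_Tinv {f : X → ℝ≥0∞} (hf : Measurable f) :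
    ∫⁻ x, f (F.Tinv x) ∂F.μ = ∫⁻ x, ENNReal.ofReal (Real.exp (F.φ x)) * f x ∂F.μ := by
  rw [← lintegral_map hf F.hTinv_meas, F.hμ_conf, lintegral_withDensity_eq_lintegral_mul]
  · rfl
  · exact (Real.measurable_exp.comp F.hφ_meas).ennreal_ofReal
  · exact hf

theorem lintegral_comp_Tinv_iterate (n : ℕ) {f : X → ℝ≥0∞} (hf : Measurable f) :
    ∫⁻ x, f (F.Tinv^[n] x) ∂F.μ
      = ∫⁻ x, ENNReal.ofReal (Real.exp (F.birk n x)) * f x ∂F.μ := by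
  induction n generalizing f with
  | zero => simp [birk]
  | succ n ih =>
    simp only [Function.iterate_succ_apply]
    rw [F.lintegral_comp_Tinv (f := fun x => f (F.Tinv^[n] x))
      (hf.comp (F.hTinv_meas.iterate n))]
    have h := ih (f := fun x => ENNReal.ofReal (Real.exp (F.φ (F.T^[n] x))) * f x)
      ((Real.measurable_exp.comp (F.hφ_meas.comp (F.hT_meas.iterate n))).ennreal_ofReal.mul hf)
    simp only [T_iterate_Tinv] at h
    rw [h]
    refine lintegral_congr fun x => ?_
    rw [birk_succ, Real.exp_add, ENNReal.ofReal_mul (Real.exp_pos _).le, mul_assoc]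

theorem setLIntegral_image_T_iterate (n : ℕ) {E : Set X} (hE : MeasurableSet E)
    {f : X → ℝ≥0∞} (hf : Measurable f) :
    ∫⁻ x in (fun y => F.T^[n] y) '' E, f x ∂F.μ
      = ∫⁻ y in E, ENNReal.ofReal (Real.exp (F.birk n y)) * f (F.T^[n] y) ∂F.μ := by
  have h := F.lintegral_comp_Tinv_iterate n
    (f := E.indicator fun y => f (F.T^[n] y)) ((hf.comp (F.hT_meas.iterate n)).indicator hE)
  rw [← lintegral_indicator (F.measurableSet_image_T_iterate n hE), ← lintegral_indicator hE]
  convert h using 2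
  · ext x
    rw [image_T_iterate]
    simp only [Set.indicator, T_iterate_Tinv]
    rfl
  · ext x
    simp only [Set.indicator]
    split_ifs <;> simp

/-- The index set of the partition `𝒫^{(1)}`. -/
def atomIndex : Finset (Σ _ : 𝒜, ℕ) := Finset.univ.sigma fun α => Finset.range (F.q α)

theorem mem_atomIndex {a : Σ _ : 𝒜, ℕ} : a ∈ F.atomIndex ↔ a.2 < F.q a.1 := by
  simp [atomIndex]

theorem pairwiseDisjoint_atom1 :
    Set.PairwiseDisjoint (↑F.atomIndex) fun a : Σ _ : 𝒜, ℕ => F.atom1 a.1 a.2 := by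
  rintro ⟨α, i⟩ ha ⟨β, j⟩ hb hne
  refine Set.disjoint_left.2 fun x hx hx' => hne ?_
  rw [F.mem_atom1_iff (F.mem_atomIndex.1 ha)] at hx
  rw [F.mem_atom1_iff (F.mem_atomIndex.1 hb)] at hx'
  obtain rfl := F.eq_of_mem_P hx.1 hx'.1
  obtain rfl := hx.2.symm.trans hx'.2
  rfl

theorem exists_mem_atom1 (x : X) : ∃ α, F.nA x < F.q α ∧ x ∈ F.atom1 α (F.nA x) := by
  obtain ⟨α, hα⟩ := F.exists_mem_P (F.renormBase x)
  exact ⟨α, F.nA_lt_q hα, (F.mem_atom1_iff (F.nA_lt_q hα)).2 ⟨hα, rfl⟩⟩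

theorem biUnion_atom1 : ⋃ a ∈ F.atomIndex, F.atom1 a.1 a.2 = Set.univ := by
  refine Set.eq_univ_of_forall fun x => ?_
  obtain ⟨α, hi, hx⟩ := F.exists_mem_atom1 x
  exact Set.mem_biUnion (x := (⟨α, F.nA x⟩ : Σ _ : 𝒜, ℕ)) (F.mem_atomIndex.2 hi) hx

theorem lintegral_eq_sum_atom1 (m : Measure X) (f : X → ℝ≥0∞) :
    ∫⁻ x, f x ∂m = ∑ α, ∑ i ∈ Finset.range (F.q α), ∫⁻ x in F.atom1 α i, f x ∂m := by
  rw [← setLIntegral_univ, ← F.biUnion_atom1, lintegral_biUnion_finset F.pairwiseDisjoint_atom1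
    fun a _ => F.measurableSet_atom1 a.1 a.2, atomIndex, Finset.sum_sigma]

theorem birkθ_succ (n : ℕ) (x : X) :
    F.birkθ (n + 1) x = F.birkθ n x + Real.exp (F.birk n x) * F.θ (F.T^[n] x) :=
  Finset.sum_range_succ _ _

theorem monotone_birkθ (x : X) : Monotone fun n => F.birkθ n x :=
  monotone_nat_of_le_succ fun n => by
    rw [birkθ_succ]
    exact le_add_of_nonneg_right (mul_nonneg (Real.exp_pos _).le (F.hθ_pos _).le)

theorem exp_ρμ : ENNReal.ofReal (Real.exp (-F.ρμ)) = F.μ F.A := by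
  have := F.hμ_prob
  rw [ρμ, neg_neg, Real.exp_log (ENNReal.toReal_pos F.hμA_pos.ne' (measure_ne_top _ _)),
    ENNReal.ofReal_toReal (measure_ne_top _ _)]

/-- The rescaled intervals over a tower add up to the full fibre over its image. -/
theorem sum_lintegral_fibre {h : ℝ → ℝ≥0∞} (hh : Measurable h) {α : 𝒜} {z : X}
    (hz : z ∈ F.P α) :
    ∑ i ∈ Finset.range (F.q α), ENNReal.ofReal (Real.exp (F.birk i (F.Rinv z))) *
        (F.μ F.A * ∫⁻ r in Set.Ico 0 (F.θ (F.T^[i] (F.Rinv z))),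
          h (Real.exp (-F.ρμ) * (Real.exp (F.birk i (F.Rinv z)) * r + F.birkθ i (F.Rinv z))))
      = ∫⁻ s in Set.Ico 0 (F.θ z), h s := by
  set y := F.Rinv z with hy
  have hstep : ∀ i, ENNReal.ofReal (Real.exp (F.birk i y)) *
        (F.μ F.A * ∫⁻ r in Set.Ico 0 (F.θ (F.T^[i] y)),
          h (Real.exp (-F.ρμ) * (Real.exp (F.birk i y) * r + F.birkθ i y)))
      = ∫⁻ s in Set.Ico (Real.exp (-F.ρμ) * F.birkθ i y)
          (Real.exp (-F.ρμ) * F.birkθ (i + 1) y), h s := by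
    intro i
    have := lintegral_Ico_comp_affine (mul_pos (Real.exp_pos (-F.ρμ)) (Real.exp_pos (F.birk i y)))
      (Real.exp (-F.ρμ) * F.birkθ i y) (F.θ (F.T^[i] y)) hh
    rw [ENNReal.ofReal_mul (Real.exp_pos _).le, exp_ρμ] at this
    rw [← mul_assoc, mul_comm (ENNReal.ofReal _)]
    convert this using 4
    · ring_nf
    · rw [birkθ_succ]
      ring
  rw [Finset.sum_congr rfl fun i _ => hstep i,
    lintegral_Ico_sum_range (fun i => Real.exp (-F.ρμ) * F.birkθ i y)
      ((F.monotone_birkθ y).const_mul (Real.exp_pos _).le)]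
  have hθ : F.birkθ (F.q α) y = Real.exp F.ρμ * F.θ z := by
    have := F.hθA y (F.hRinv_A z)
    rw [hy, F.rA_Rinv hz, F.hR_Rinv] at this
    exact this
  rw [hθ, ← mul_assoc, ← Real.exp_add, neg_add_cancel, Real.exp_zero, one_mul]
  simp [birkθ]

theorem lintegral_comp_Rμ {f : X × ℝ → ℝ≥0∞} (hf : Measurable f) :
    ∫⁻ p, f (F.Rμ p) ∂F.μθ = ∫⁻ p, f p ∂F.μθ := by
  have := F.hμ_prob
  have hμA := F.hμA_pos.ne'
  have hmeas : Measurable fun x => ∫⁻ r in Set.Ico 0 (F.θ x), f (F.Rμ (x, r)) :=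
    F.measurable_lintegral_fibre (hf.comp F.measurable_Rμ)
  have hmeasK := F.measurable_lintegral_fibre hf
  rw [F.lintegral_μθ (f := fun p => f (F.Rμ p)) (hf.comp F.measurable_Rμ), F.lintegral_μθ hf]
  refine (ENNReal.mul_right_inj hμA (measure_ne_top _ _)).1 ?_
  have hpush : ∫⁻ y in F.A, (∫⁻ s in Set.Ico 0 (F.θ (F.R y)), f (F.R y, s)) ∂F.μ
      = F.μ F.A * ∫⁻ x, (∫⁻ s in Set.Ico 0 (F.θ x), f (x, s)) ∂F.μ := by
    rw [← lintegral_map (f := fun x => ∫⁻ s in Set.Ico 0 (F.θ x), f (x, s)) hmeasK F.hR_meas,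
      F.hR_push, lintegral_smul_measure, smul_eq_mul]
  have hAu : F.A = ⋃ α ∈ (Finset.univ : Finset 𝒜), F.Rinv '' F.P α := by
    ext x
    simp only [Finset.mem_univ, Set.iUnion_true, Set.mem_iUnion, image_Rinv, Set.mem_inter_iff,
      Set.mem_preimage]
    exact ⟨fun h => (F.exists_mem_P (F.R x)).imp fun _ h' => ⟨h', h⟩, fun ⟨_, _, h⟩ => h⟩
  rw [← hpush, F.lintegral_eq_sum_atom1]
  conv_rhs => rw [hAu]
  rw [lintegral_biUnion_finset (t := fun α => F.Rinv '' F.P α), Finset.mul_sum]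
  · refine Finset.sum_congr rfl fun α _ => ?_
    have hE := F.measurableSet_image_Rinv (F.hP_meas α)
    have hterm : ∀ i ∈ Finset.range (F.q α),
        F.μ F.A * ∫⁻ x in F.atom1 α i, (∫⁻ r in Set.Ico 0 (F.θ x), f (F.Rμ (x, r))) ∂F.μ
          = ∫⁻ y in F.Rinv '' F.P α, F.μ F.A * (ENNReal.ofReal (Real.exp (F.birk i y)) *
            ∫⁻ r in Set.Ico 0 (F.θ (F.T^[i] y)), f (F.Rμ (F.T^[i] y, r))) ∂F.μ := by
      intro i _
      rw [atom1, F.setLIntegral_image_T_iterate i hE hmeas, lintegral_const_mul]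
      exact (Real.measurable_exp.comp (F.measurable_birk i)).ennreal_ofReal.mul
        (hmeas.comp (F.hT_meas.iterate i))
    rw [Finset.mul_sum, Finset.sum_congr rfl hterm, ← lintegral_finsetSum]
    · refine setLIntegral_congr_fun hE ?_
      rintro _ ⟨z, hz, rfl⟩
      simp only [F.hR_Rinv]
      rw [← F.sum_lintegral_fibre (h := fun s => f (z, s)) (hf.comp measurable_prodMk_left) hz]
      refine Finset.sum_congr rfl fun i hi => ?_
      have hi' := Finset.mem_range.1 hi
      simp only [Rμ, F.nA_T_iterate_Rinv hz hi', Tinv_iterate_T, F.hR_Rinv]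
      ring
    · exact fun i _ => measurable_const.mul
        ((Real.measurable_exp.comp (F.measurable_birk i)).ennreal_ofReal.mul
        (hmeas.comp (F.hT_meas.iterate i)))
  · intro α _ β _ hne
    refine Set.disjoint_left.2 ?_
    rintro _ hx hx'
    simp only [image_Rinv] at hx hx'
    exact hne (F.eq_of_mem_P hx.1 hx'.1)
  · exact fun α _ => F.measurableSet_image_Rinv (F.hP_meas α)

theorem measurePreserving_Rμ : MeasurePreserving F.Rμ F.μθ F.μθ := by
  refine ⟨F.measurable_Rμ, Measure.ext fun B hB => ?_⟩
  rw [Measure.map_apply F.measurable_Rμ hB, ← lintegral_indicator_one hB,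
    ← lintegral_indicator_one (F.measurable_Rμ hB),
    ← F.lintegral_comp_Rμ (measurable_one.indicator hB)]
  rfl

theorem integrable_θ : Integrable F.θ F.μ := by
  by_contra h
  exact zero_ne_one ((integral_undef h).symm.trans F.hθ_int)

theorem μθ_preimage_fst {S : Set X} (hS : MeasurableSet S) :
    F.μθ (Prod.fst ⁻¹' S) = ENNReal.ofReal (∫ x in S, F.θ x ∂F.μ) := by
  rw [ofReal_integral_eq_lintegral_ofReal F.integrable_θ.integrableOn
      (Eventually.of_forall fun x => (F.hθ_pos x).le),
    ← lintegral_indicator_one (measurable_fst hS),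
    F.lintegral_μθ (measurable_one.indicator (measurable_fst hS)), ← lintegral_indicator hS]
  refine lintegral_congr fun x => ?_
  by_cases hx : x ∈ S
  · have h1 : ∀ r : ℝ, (x, r) ∈ (Prod.fst ⁻¹' S : Set (X × ℝ)) := fun _ => hx
    simp [Set.indicator, h1, hx]
  · have h1 : ∀ r : ℝ, (x, r) ∉ (Prod.fst ⁻¹' S : Set (X × ℝ)) := fun _ => hx
    simp [Set.indicator, h1, hx]

theorem isProbabilityMeasure_μθ : IsProbabilityMeasure F.μθ := by
  refine ⟨?_⟩
  have h := F.μθ_preimage_fst MeasurableSet.univ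
  rwa [Set.preimage_univ, setIntegral_univ, F.hθ_int, ENNReal.ofReal_one] at h

theorem μθ_real_preimage_fst {S : Set X} (hS : MeasurableSet S) :
    F.μθ.real (Prod.fst ⁻¹' S) = ∫ x in S, F.θ x ∂F.μ := by
  rw [measureReal_def, F.μθ_preimage_fst hS, ENNReal.toReal_ofReal]
  exact integral_nonneg fun x => (F.hθ_pos x).le

theorem ae_of_ae_μθ {p : X → Prop} (h : ∀ᵐ z ∂F.μθ, p z.1) : ∀ᵐ x ∂F.μ, p x := by
  have := F.hμ_prob
  rw [μθ, ae_restrict_iff' F.measurableSet_Xθ] at h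
  filter_upwards [Measure.ae_ae_of_ae_prod h] with x hx
  by_contra hp
  have h0 : volume (Set.Ico 0 (F.θ x)) = 0 :=
    measure_eq_zero_iff_ae_notMem.2 (hx.mono fun r hr hmem => hp (hr hmem))
  rw [Real.volume_Ico, sub_zero, ENNReal.ofReal_eq_zero] at h0
  exact absurd h0 (not_le.2 (F.hθ_pos x))

theorem RμErgodic.ergodic {F : CRF X 𝒜} (h : F.RμErgodic) : Ergodic F.Rμ F.μθ := by
  have := F.isProbabilityMeasure_μθ
  refine ⟨F.measurePreserving_Rμ, ⟨fun s hs hinv => ?_⟩⟩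
  rw [eventuallyConst_set']
  rcases h s hs (by simp [hinv]) with h0 | h1
  · exact Or.inl (ae_eq_empty.2 h0)
  · exact Or.inr (eventuallyEq_univ.2 ((mem_ae_iff_prob_eq_one hs).2 h1))

/-- The function with the value `w α i` on the atom `Tⁱ(R⁻¹ P_α)`. -/
noncomputable def atomSum (w : 𝒜 → ℕ → ℝ) (x : X) : ℝ :=
  ∑ α, ∑ i ∈ Finset.range (F.q α), (F.atom1 α i).indicator (fun _ => w α i) x

theorem atomSum_eq (w : 𝒜 → ℕ → ℝ) {x : X} {α : 𝒜} (h : F.renormBase x ∈ F.P α) :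
    F.atomSum w x = w α (F.nA x) := by
  have hlt := F.nA_lt_q h
  rw [atomSum, Finset.sum_eq_single α, Finset.sum_eq_single (F.nA x)]
  · exact Set.indicator_of_mem ((F.mem_atom1_iff hlt).2 ⟨h, rfl⟩) _
  · intro i hi hne
    refine Set.indicator_of_notMem (fun hx => hne ?_) _
    exact ((F.mem_atom1_iff (Finset.mem_range.1 hi)).1 hx).2.symm
  · exact fun hx => absurd (Finset.mem_range.2 hlt) hx
  · intro β _ hne
    refine Finset.sum_eq_zero fun i hi => Set.indicator_of_notMem (fun hx => hne ?_) _
    exact F.eq_of_mem_P ((F.mem_atom1_iff (Finset.mem_range.1 hi)).1 hx).1 h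
  · exact fun hx => absurd (Finset.mem_univ _) hx

theorem measurable_atomSum (w : 𝒜 → ℕ → ℝ) : Measurable (F.atomSum w) :=
  Finset.measurable_sum _ fun α _ => Finset.measurable_sum _ fun i _ =>
    measurable_const.indicator (F.measurableSet_atom1 α i)

theorem integrable_indicator_fst (α : 𝒜) (i : ℕ) (c : ℝ) :
    Integrable (fun p : X × ℝ => (F.atom1 α i).indicator (fun _ => c) p.1) F.μθ := by
  have := F.isProbabilityMeasure_μθ
  exact (integrable_const c).indicator (measurable_fst (F.measurableSet_atom1 α i))

theorem integrable_atomSum (w : 𝒜 → ℕ → ℝ) :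
    Integrable (fun p : X × ℝ => F.atomSum w p.1) F.μθ :=
  integrable_finsetSum _ fun α _ => integrable_finsetSum _ fun i _ =>
    F.integrable_indicator_fst α i (w α i)

theorem integral_atomSum (w : 𝒜 → ℕ → ℝ) :
    ∫ p, F.atomSum w p.1 ∂F.μθ
      = ∑ α, ∑ i ∈ Finset.range (F.q α), w α i * ∫ x in F.atom1 α i, F.θ x ∂F.μ := by
  simp only [atomSum]
  rw [integral_finsetSum _ fun α _ => integrable_finsetSum _ fun i _ =>
    F.integrable_indicator_fst α i (w α i)]
  refine Finset.sum_congr rfl fun α _ => ?_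
  rw [integral_finsetSum _ fun i _ => F.integrable_indicator_fst α i (w α i)]
  refine Finset.sum_congr rfl fun i _ => ?_
  have hm := F.measurableSet_atom1 α i
  rw [← F.μθ_real_preimage_fst hm, mul_comm, ← smul_eq_mul,
    ← integral_indicator_const _ (measurable_fst hm)]
  rfl

/-- Averages over `X^θ` of functions of the atom of `𝒫` are unchanged by the renormalization. -/
theorem sum_itinerary_eq (v : 𝒜 → ℝ) :
    ∑ α, ∑ i ∈ Finset.range (F.q α), v (F.βm α i) * ∫ x in F.atom1 α i, F.θ x ∂F.μ
      = ∑ α, ∑ i ∈ Finset.range (F.q α), v α * ∫ x in F.atom1 α i, F.θ x ∂F.μ := by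
  rw [← F.integral_atomSum fun α i => v (F.βm α i), ← F.integral_atomSum fun α _ => v α]
  have hcomp : ∀ p : X × ℝ, F.atomSum (fun α _ => v α) p.1
      = F.atomSum (fun α i => v (F.βm α i)) (F.Rμ p).1 := by
    intro p
    obtain ⟨α, hα⟩ := F.exists_mem_P (F.renormBase p.1)
    obtain ⟨β, hβ⟩ := F.exists_mem_P (F.renormBase (F.renormBase p.1))
    change _ = F.atomSum _ (F.renormBase p.1)
    rw [F.atomSum_eq _ hα, F.atomSum_eq _ hβ]
    have hlt := F.nA_lt_q hβ
    rw [F.eq_of_mem_P hα (F.atom1_subset hlt ((F.mem_atom1_iff hlt).2 ⟨hβ, rfl⟩))]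
  simp_rw [hcomp]
  have hP := F.measurePreserving_Rμ
  rw [← integral_map (f := fun p : X × ℝ => F.atomSum (fun α i => v (F.βm α i)) p.1)
    hP.measurable.aemeasurable, hP.map_eq]
  rw [hP.map_eq]
  exact (F.integrable_atomSum _).aestronglyMeasurable

theorem sum_integral_atom1 :
    ∑ α, ∑ i ∈ Finset.range (F.q α), ∫ x in F.atom1 α i, F.θ x ∂F.μ = 1 := by
  have := F.isProbabilityMeasure_μθ
  have h := F.integral_atomSum fun _ _ => 1
  simp only [one_mul] at h
  rw [← h]
  have h1 : ∀ x, F.atomSum (fun _ _ => 1) x = 1 := fun x => by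
    obtain ⟨α, hα⟩ := F.exists_mem_P (F.renormBase x)
    exact F.atomSum_eq _ hα
  simp [h1]

theorem integral_atom1_pos {α : 𝒜} {i : ℕ} (h : 0 < F.μ (F.atom1 α i)) :
    0 < ∫ x in F.atom1 α i, F.θ x ∂F.μ := by
  rw [setIntegral_pos_iff_support_of_nonneg_ae (Eventually.of_forall fun x => (F.hθ_pos x).le)
    F.integrable_θ.integrableOn]
  have : Function.support F.θ = Set.univ := Set.eq_univ_of_forall fun x => (F.hθ_pos x).ne'
  rwa [this, Set.univ_inter]

theorem fst_Rμ_iterate (n : ℕ) (p : X × ℝ) : (F.Rμ^[n] p).1 = F.renormBase^[n] p.1 := by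
  have h : Function.Semiconj Prod.fst F.Rμ F.renormBase := fun _ => rfl
  exact h.iterate_right n p

/-- The information function of the rescaling, `-log (ν(Tⁱ R⁻¹P_α) / ν(P_α))` on the atom
`Tⁱ(R⁻¹ P_α)`. -/
noncomputable def info (ν : Measure X) (α : 𝒜) (i : ℕ) : ℝ :=
  -Real.log ((ν (F.atom1 α i)).toReal / (ν (F.P α)).toReal)

theorem abs_neg_log_measure_Pn_sub_le {ν : Measure X} [IsProbabilityMeasure ν]
    (hνP : ∀ α, 0 < ν (F.P α)) (hνP1 : ∀ α, ∀ i < F.q α, 0 < ν (F.atom1 α i))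
    (hscale : ∀ α, ∀ i < F.q α, ∀ E, MeasurableSet E → E ⊆ F.P α →
      ν ((fun y => F.T^[i] y) '' (F.Rinv '' E)) * ν (F.P α) = ν (F.atom1 α i) * ν E)
    (n : ℕ) (x : X) :
    0 < ν (F.Pn n x) ∧
    |-Real.log (ν (F.Pn n x)).toReal - birkhoffSum F.renormBase (F.atomSum (F.info ν)) n x|
      ≤ ∑ α, |Real.log (ν (F.P α)).toReal| := by
  induction n generalizing x with
  | zero =>
    obtain ⟨α, hα⟩ := F.exists_mem_P x
    rw [F.hPn0 α x hα, birkhoffSum_zero, sub_zero, abs_neg]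
    exact ⟨hνP α, Finset.single_le_sum (f := fun α => |Real.log (ν (F.P α)).toReal|)
      (fun _ _ => abs_nonneg _) (Finset.mem_univ α)⟩
  | succ n ih =>
    obtain ⟨α, hα⟩ := F.exists_mem_P (F.renormBase x)
    have hlt := F.nA_lt_q hα
    obtain ⟨hpos, hle⟩ := ih (F.renormBase x)
    have hmul := hscale α _ hlt _ (F.measurableSet_Pn n (F.renormBase x)) (F.Pn_subset_P n hα)
    rw [← F.Pn_succ n x] at hmul
    have hpos' : 0 < ν (F.Pn (n + 1) x) := by
      rw [pos_iff_ne_zero]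
      intro h0
      rw [h0, zero_mul] at hmul
      exact mul_ne_zero (hνP1 α _ hlt).ne' hpos.ne' hmul.symm
    refine ⟨hpos', ?_⟩
    have hreal := fun {S : Set X} (h : 0 < ν S) =>
      (ENNReal.toReal_pos h.ne' (measure_ne_top ν S)).ne'
    have hlog := congrArg (fun t => Real.log t.toReal) hmul
    simp only [ENNReal.toReal_mul] at hlog
    rw [Real.log_mul (hreal hpos') (hreal (hνP α)),
      Real.log_mul (hreal (hνP1 α _ hlt)) (hreal hpos)] at hlog
    rw [birkhoffSum_succ', F.atomSum_eq _ hα, info,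
      Real.log_div (hreal (hνP1 α _ hlt)) (hreal (hνP α))]
    convert hle using 2
    linarith

theorem Hu_eq {ν : Measure X} [IsProbabilityMeasure ν]
    (hνP : ∀ α, 0 < ν (F.P α)) (hνP1 : ∀ α, ∀ i < F.q α, 0 < ν (F.atom1 α i)) :
    F.Hu ν = -∑ α : 𝒜, ∑ i ∈ Finset.range (F.q α),
      Real.log ((ν (F.atom1 α i)).toReal / (ν (F.P α)).toReal) *
        ∫ x in F.atom1 α i, F.θ x ∂F.μ := by
  have hreal := fun {S : Set X} (h : 0 < ν S) =>
    (ENNReal.toReal_pos h.ne' (measure_ne_top ν S)).ne'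
  have hsplit : ∀ γ : 𝒜 → ℕ → 𝒜, ∑ α : 𝒜, ∑ i ∈ Finset.range (F.q α),
      Real.log ((ν (F.atom1 α i)).toReal / (ν (F.P (γ α i))).toReal) *
        ∫ x in F.atom1 α i, F.θ x ∂F.μ
      = ∑ α : 𝒜, ∑ i ∈ Finset.range (F.q α),
          Real.log (ν (F.atom1 α i)).toReal * ∫ x in F.atom1 α i, F.θ x ∂F.μ
        - ∑ α : 𝒜, ∑ i ∈ Finset.range (F.q α),
          Real.log (ν (F.P (γ α i))).toReal * ∫ x in F.atom1 α i, F.θ x ∂F.μ := by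
    intro γ
    simp only [← Finset.sum_sub_distrib]
    refine Finset.sum_congr rfl fun α _ => Finset.sum_congr rfl fun i hi => ?_
    rw [Real.log_div (hreal (hνP1 α i (Finset.mem_range.1 hi))) (hreal (hνP _)), sub_mul]
  rw [Hu, hsplit F.βm, hsplit fun α _ => α,
    F.sum_itinerary_eq fun α => Real.log (ν (F.P α)).toReal]

theorem Hu_pos {ν : Measure X} [IsProbabilityMeasure ν]
    (hμP1 : ∀ α, ∀ i < F.q α, 0 < F.μ (F.atom1 α i))
    (hνP1 : ∀ α, ∀ i < F.q α, 0 < ν (F.atom1 α i))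
    {γ α₁ α₂ : 𝒜} {i₁ i₂ : ℕ} (h₁ : i₁ < F.q α₁) (h₂ : i₂ < F.q α₂)
    (hne : F.atom1 α₁ i₁ ≠ F.atom1 α₂ i₂)
    (hs₁ : F.atom1 α₁ i₁ ⊆ F.P γ) (hs₂ : F.atom1 α₂ i₂ ⊆ F.P γ) : 0 < F.Hu ν := by
  have hreal := fun {S : Set X} (h : 0 < ν S) => ENNReal.toReal_pos h.ne' (measure_ne_top ν S)
  have hdiv : ∀ α, ∀ i < F.q α,
      (ν (F.atom1 α i)).toReal / (ν (F.P (F.βm α i))).toReal ≤ 1 := fun α i hi =>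
    div_le_one_of_le₀ (ENNReal.toReal_mono (measure_ne_top _ _) (measure_mono (F.atom1_subset hi)))
      ENNReal.toReal_nonneg
  have hterm : ∀ α, ∀ i ∈ Finset.range (F.q α),
      0 ≤ -(Real.log ((ν (F.atom1 α i)).toReal / (ν (F.P (F.βm α i))).toReal) *
        ∫ x in F.atom1 α i, F.θ x ∂F.μ) := by
    intro α i hi
    rw [← neg_mul]
    refine mul_nonneg (neg_nonneg.2 (Real.log_nonpos (by positivity)
      (hdiv α i (Finset.mem_range.1 hi)))) (integral_nonneg fun x => (F.hθ_pos x).le)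
  obtain ⟨x, hx⟩ := nonempty_of_measure_ne_zero (hνP1 _ _ h₁).ne'
  obtain rfl : γ = F.βm α₁ i₁ := F.eq_of_mem_P (hs₁ hx) (F.atom1_subset h₁ hx)
  have hdisj : Disjoint (F.atom1 α₁ i₁) (F.atom1 α₂ i₂) :=
    F.pairwiseDisjoint_atom1 (x := ⟨α₁, i₁⟩) (F.mem_atomIndex.2 h₁) (y := ⟨α₂, i₂⟩)
      (F.mem_atomIndex.2 h₂) (fun h => hne (by cases h; rfl))
  have hlt : (ν (F.atom1 α₁ i₁)).toReal < (ν (F.P (F.βm α₁ i₁))).toReal := by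
    rw [ENNReal.toReal_lt_toReal (measure_ne_top _ _) (measure_ne_top _ _)]
    calc ν (F.atom1 α₁ i₁) < ν (F.atom1 α₁ i₁) + ν (F.atom1 α₂ i₂) :=
          ENNReal.lt_add_right (measure_ne_top _ _) (hνP1 _ _ h₂).ne'
      _ = ν (F.atom1 α₁ i₁ ∪ F.atom1 α₂ i₂) :=
          (measure_union hdisj (F.measurableSet_atom1 _ _)).symm
      _ ≤ _ := measure_mono (Set.union_subset hs₁ hs₂)
  have hpos := hreal (hνP1 _ _ h₁)
  rw [Hu]
  simp only [← Finset.sum_neg_distrib]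
  refine Finset.sum_pos' (fun α _ => Finset.sum_nonneg (hterm α)) ⟨α₁, Finset.mem_univ _, ?_⟩
  refine Finset.sum_pos' (hterm α₁) ⟨i₁, Finset.mem_range.2 h₁, ?_⟩
  rw [← neg_mul]
  refine mul_pos (neg_pos.2 (Real.log_neg (div_pos hpos (hpos.trans hlt)) ?_))
    (F.integral_atom1_pos (hμP1 _ _ h₁))
  rwa [div_lt_one (hpos.trans hlt)]

theorem ae_tendsto_neg_log_measure_Pn (herg : F.RμErgodic) {ν : Measure X}
    [IsProbabilityMeasure ν] (hνP : ∀ α, 0 < ν (F.P α))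
    (hνP1 : ∀ α, ∀ i < F.q α, 0 < ν (F.atom1 α i))
    (hscale : ∀ α, ∀ i < F.q α, ∀ E, MeasurableSet E → E ⊆ F.P α →
      ν ((fun y => F.T^[i] y) '' (F.Rinv '' E)) * ν (F.P α) = ν (F.atom1 α i) * ν E) :
    ∀ᵐ x ∂F.μ, Tendsto (fun n : ℕ => -(Real.log (ν (F.Pn n x)).toReal) / n)
      atTop (nhds (F.Hu ν)) := by
  have := F.isProbabilityMeasure_μθ
  refine F.ae_of_ae_μθ ?_
  have hlim : ∫ p, F.atomSum (F.info ν) p.1 ∂F.μθ = F.Hu ν := by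
    rw [F.integral_atomSum, F.Hu_eq hνP hνP1]
    simp only [info, neg_mul, Finset.sum_neg_distrib]
  filter_upwards [herg.ergodic.ae_tendsto_birkhoffSum_div
    (g := fun p : X × ℝ => F.atomSum (F.info ν) p.1)
    ((F.measurable_atomSum _).comp measurable_fst) (F.integrable_atomSum _)] with p hp
  rw [hlim] at hp
  have hbirk : ∀ n, birkhoffSum F.Rμ (fun p : X × ℝ => F.atomSum (F.info ν) p.1) n p
      = birkhoffSum F.renormBase (F.atomSum (F.info ν)) n p.1 := by
    simp [birkhoffSum, fst_Rμ_iterate]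
  simp only [hbirk] at hp
  set C := ∑ α, |Real.log (ν (F.P α)).toReal|
  have herr : Tendsto (fun n : ℕ => (-Real.log (ν (F.Pn n p.1)).toReal
      - birkhoffSum F.renormBase (F.atomSum (F.info ν)) n p.1) / n) atTop (nhds 0) := by
    refine squeeze_zero_norm (fun n => ?_) (tendsto_const_div_atTop_nhds_zero_nat C)
    rw [norm_div, Real.norm_eq_abs, Real.norm_natCast]
    exact div_le_div_of_nonneg_right
      (F.abs_neg_log_measure_Pn_sub_le hνP hνP1 hscale n p.1).2 (Nat.cast_nonneg n)
  simpa [← add_div] using herr.add hp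

end CRF

/-- Perfectly scaled renormalizations, case `λ = 0`: if `R_μ` is ergodic and `ν` is the
unique `ψ`-conformal probability measure, with `ψ` constant on atoms of `𝒫` and
perfectly scaled (`ψ_A ∘ R⁻¹ = ψ`), then for `μ`-a.e. `x`,
`-(1/n) log ν(P^{(n)}(x)) → H^u_ν(R_μ)`; moreover `H^u_ν(R_μ)` is also given by the
formula with `P_α` in place of `P_{β(α,i)}`, it is positive, and if `ν` is
`T`-invariant it equals `ρ_ν = -log ν(A)`. -/
theorem perfectly_scaled_information_content
    {X : Type*} [MetricSpace X] [CompactSpace X] [MeasurableSpace X] [BorelSpace X]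
    {𝒜 : Type*} [Fintype 𝒜]
    (F : CRF X 𝒜)
    (herg : F.RμErgodic)
    (ψ : X → ℝ) (ν : Measure X) (hνprob : IsProbabilityMeasure ν)
    (hνconf : ν.map F.Tinv = ν.withDensity fun x => ENNReal.ofReal (Real.exp (ψ x)))
    (hψconst : ∀ α : 𝒜, ∀ x ∈ F.P α, ∀ y ∈ F.P α, ψ x = ψ y)
    (hψscale : ∀ x ∈ F.A, (∑ i ∈ Finset.range (F.rA x), ψ (F.T^[i] x)) = ψ (F.R x))
    (hνuniq : ∀ ν' : Measure X, IsProbabilityMeasure ν' →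
      ν'.map F.Tinv = ν'.withDensity (fun x => ENNReal.ofReal (Real.exp (ψ x))) → ν' = ν)
    (hμP : ∀ α : 𝒜, 0 < F.μ (F.P α)) (hνP : ∀ α : 𝒜, 0 < ν (F.P α))
    (hμP1 : ∀ α : 𝒜, ∀ i < F.q α, 0 < F.μ (F.atom1 α i))
    (hνP1 : ∀ α : 𝒜, ∀ i < F.q α, 0 < ν (F.atom1 α i))
    (htwo : ∃ γ : 𝒜, ∃ α₁ : 𝒜, ∃ i₁ : ℕ, ∃ α₂ : 𝒜, ∃ i₂ : ℕ,
      i₁ < F.q α₁ ∧ i₂ < F.q α₂ ∧ F.atom1 α₁ i₁ ≠ F.atom1 α₂ i₂ ∧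
      F.atom1 α₁ i₁ ⊆ F.P γ ∧ F.atom1 α₂ i₂ ⊆ F.P γ) :
    (∀ᵐ x ∂F.μ, Tendsto
        (fun n : ℕ => -(Real.log ((ν (F.Pn n x)).toReal)) / n)
        atTop (nhds (F.Hu ν))) ∧
    F.Hu ν
      = -∑ α : 𝒜, ∑ i ∈ Finset.range (F.q α),
          Real.log (((ν (F.atom1 α i)).toReal) / ((ν (F.P α)).toReal)) *
            ∫ x in F.atom1 α i, F.θ x ∂F.μ ∧
    0 < F.Hu ν ∧
    (ν.map F.T = ν → F.Hu ν = -Real.log ((ν F.A).toReal)) := by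
  choose z hz using fun α => nonempty_of_measure_ne_zero (hνP α).ne'
  set c : 𝒜 → ℝ≥0∞ := fun α => ENNReal.ofReal (Real.exp (ψ (z α)))
  have hc : ∀ α, ∀ x ∈ F.P α, ENNReal.ofReal (Real.exp (ψ x)) = c α := fun α x hx => by
    rw [hψconst α x hx _ (hz α)]
  have hscaled : F.ScaledBy c ν := (CRF.map_eq_withDensity_iff_scaledBy hc).1 hνconf
  have hprod : ∀ α, (F.P α).Nonempty → ∏ k ∈ Finset.range (F.q α), c (F.βm α k) = c α :=
    fun α ⟨_, hx⟩ => CRF.prod_scaling hψscale hc hx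
  obtain ⟨γ, α₁, i₁, α₂, i₂, h₁, h₂, hne, hs₁, hs₂⟩ := htwo
  have hA : ν F.A ≠ 0 := by
    refine ne_of_gt ((hνP1 γ 0 (F.hq_pos γ)).trans_le (measure_mono ?_))
    rintro _ ⟨_, ⟨y, -, rfl⟩, rfl⟩
    exact F.hRinv_A y
  have hRinv : ∀ E, MeasurableSet E → ν (F.Rinv '' E) = ν F.A * ν E := fun E hE =>
    CRF.measure_image_Rinv_of_unique hscaled hprod
      (fun m' hm' h => hνuniq m' hm' ((CRF.map_eq_withDensity_iff_scaledBy hc).2 h)) hA hE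
  have himage : ∀ α, ∀ i < F.q α, ∀ E, MeasurableSet E → E ⊆ F.P α →
      ν ((fun y => F.T^[i] y) '' (F.Rinv '' E))
        = (∏ k ∈ Finset.range i, c (F.βm α k)) * (ν F.A * ν E) := fun α i hi E hE hsub => by
    rw [hscaled.measure_image_T_iterate_Rinv hE hsub hi.le, hRinv E hE]
  have hatom : ∀ α, ∀ i < F.q α, ν (F.atom1 α i)
      = (∏ k ∈ Finset.range i, c (F.βm α k)) * (ν F.A * ν (F.P α)) := fun α i hi =>
    himage α i hi _ (F.hP_meas α) subset_rfl
  have hHu := F.Hu_eq hνP hνP1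
  refine ⟨F.ae_tendsto_neg_log_measure_Pn herg hνP hνP1 fun α i hi E hE hsub => ?_, hHu,
    F.Hu_pos hμP1 hνP1 h₁ h₂ hne hs₁ hs₂, fun hinv => ?_⟩
  · rw [himage α i hi E hE hsub, hatom α i hi]
    ring
  · have hc1 : ∀ α, c α = 1 := by
      intro α
      have h := hscaled α _ (F.hP_meas α) subset_rfl
      rw [← hinv, Measure.map_apply F.hT_meas (F.hTinv_meas (F.hP_meas α)),
        ← Set.preimage_comp, F.hT_left.comp_eq_id, Set.preimage_id, hinv] at h
      refine (ENNReal.mul_left_inj (hνP α).ne' (measure_ne_top ν _)).1 ?_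
      rw [one_mul, ← h]
    have hratio : ∀ α, ∀ i ∈ Finset.range (F.q α),
        Real.log ((ν (F.atom1 α i)).toReal / (ν (F.P α)).toReal) *
          ∫ x in F.atom1 α i, F.θ x ∂F.μ
        = Real.log (ν F.A).toReal * ∫ x in F.atom1 α i, F.θ x ∂F.μ := by
      intro α i hi
      rw [hatom α i (Finset.mem_range.1 hi)]
      have hPpos := ENNReal.toReal_pos (hνP α).ne' (measure_ne_top ν _)
      simp [hc1, hPpos.ne']
    rw [hHu, Finset.sum_congr rfl fun α _ => Finset.sum_congr rfl (hratio α)]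
    simp only [← Finset.mul_sum]
    rw [F.sum_integral_atom1, mul_one]
end

section
/- Let (X, 𝓑) be a measurable space, T : X → X a measurable bijection with measurable inverse, φ, θ : X → ℝ measurable functions, and μ a probability measure on X that is φ-conformal for T, i.e. (T⁻¹)_*μ equals the measure with density e^{φ} with respect to μ. Then the skew product T_θ : X × ℝ → X × ℝ defined by T_θ(x, r) = (T(x), e^{−φ(x)}·(r − θ(x))) is a measurable bijection with measurable inverse which preserves the product measure μ ⊗ Leb, where Leb is Lebesgue measure on ℝ. -/
open MeasureTheory
open scoped ENNReal

/-- The affine map `r ↦ e^{-a} (r - b)` scales Lebesgue measure of preimages by `e^a`. -/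
theorem volume_preimage_exp_neg_mul_sub (a b : ℝ) (s : Set ℝ) :
    volume ((fun r : ℝ => Real.exp (-a) * (r - b)) ⁻¹' s) =
      ENNReal.ofReal (Real.exp a) * volume s := by
  have h : (fun r : ℝ => Real.exp (-a) * (r - b)) ⁻¹' s =
      (fun r : ℝ => r - b) ⁻¹' ((fun r : ℝ => Real.exp (-a) * r) ⁻¹' s) := rfl
  simp only [sub_eq_add_neg] at h ⊢
  rw [h, measure_preimage_add_right, Real.volume_preimage_mul_left (Real.exp_ne_zero _),
    ← Real.exp_neg, neg_neg, abs_of_pos (Real.exp_pos _)]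

/-- Let `μ` be a `φ`-conformal probability measure for an invertible measurable map `T`
(i.e. `(T⁻¹)_* μ = e^φ · μ`). Then the skew product
`T_θ(x, r) = (T x, e^{-φ x} (r - θ x))` is a measurable bijection with measurable
inverse which preserves the product measure `μ ⊗ Leb`. -/
theorem skewProduct_measurePreserving
    {X : Type*} [MeasurableSpace X]
    (T Tinv : X → X) (hTmeas : Measurable T) (hTinvmeas : Measurable Tinv)
    (hleft : Function.LeftInverse Tinv T) (hright : Function.RightInverse Tinv T)
    (φ θ : X → ℝ) (hφ : Measurable φ) (hθ : Measurable θ)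
    (μ : Measure X) [IsProbabilityMeasure μ]
    (hconf : μ.map Tinv = μ.withDensity fun x => ENNReal.ofReal (Real.exp (φ x))) :
    Function.Bijective (fun p : X × ℝ => (T p.1, Real.exp (-φ p.1) * (p.2 - θ p.1))) ∧
    Measurable (fun p : X × ℝ => (T p.1, Real.exp (-φ p.1) * (p.2 - θ p.1))) ∧
    (∃ S : X × ℝ → X × ℝ, Measurable S ∧
      Function.LeftInverse S (fun p : X × ℝ => (T p.1, Real.exp (-φ p.1) * (p.2 - θ p.1))) ∧
      Function.RightInverse S (fun p : X × ℝ => (T p.1, Real.exp (-φ p.1) * (p.2 - θ p.1)))) ∧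
    Measure.map (fun p : X × ℝ => (T p.1, Real.exp (-φ p.1) * (p.2 - θ p.1)))
      (μ.prod volume) = μ.prod volume := by
  set f : X × ℝ → X × ℝ := fun p => (T p.1, Real.exp (-φ p.1) * (p.2 - θ p.1))
  have hfmeas : Measurable f := by fun_prop
  let S : X × ℝ → X × ℝ := fun q => (Tinv q.1, Real.exp (φ (Tinv q.1)) * q.2 + θ (Tinv q.1))
  have hSmeas : Measurable S := by fun_prop
  have hSleft : Function.LeftInverse S f := by
    rintro ⟨x, r⟩
    simp [S, f, hleft x, ← mul_assoc, ← Real.exp_add]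
  have hSright : Function.RightInverse S f := by
    rintro ⟨y, s⟩
    simp [S, f, hright y, ← mul_assoc, ← Real.exp_add]
  refine ⟨⟨hSleft.injective, hSright.surjective⟩, hfmeas, ⟨S, hSmeas, hSleft, hSright⟩, ?_⟩
  ext A hA
  have hslice : Measurable fun x => volume (Prod.mk x ⁻¹' A : Set ℝ) :=
    measurable_measure_prodMk_left hA
  rw [Measure.map_apply hfmeas hA, Measure.prod_apply (hfmeas hA), Measure.prod_apply hA]
  calc ∫⁻ x, volume (Prod.mk x ⁻¹' (f ⁻¹' A) : Set ℝ) ∂μ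
      = ∫⁻ x, ENNReal.ofReal (Real.exp (φ x)) * volume (Prod.mk (T x) ⁻¹' A : Set ℝ) ∂μ :=
        lintegral_congr fun x =>
          volume_preimage_exp_neg_mul_sub (φ x) (θ x) (Prod.mk (T x) ⁻¹' A)
    _ = ∫⁻ x, volume (Prod.mk (T x) ⁻¹' A : Set ℝ) ∂(μ.map Tinv) := by
        rw [hconf]
        exact (lintegral_withDensity_eq_lintegral_mul _ (by fun_prop)
          (hslice.comp hTmeas)).symm
    _ = ∫⁻ y, volume (Prod.mk y ⁻¹' A : Set ℝ) ∂μ := by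
        refine (lintegral_map (hslice.comp hTmeas) hTinvmeas).trans ?_
        simp only [Function.comp_apply, hright _]
end
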